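/- Let U: A₁⊗…⊗A_n → C₁⊗…⊗C_m be a minimally I₃-scrambling MIMO unitary. Then there exist decompositions A₁ = ⊗_{j=1}^m A_{1→j} and C_j = C_{1→j} ⊗ C'_j for j = 1,…,m, unitaries U_{1→j}: A_{1→j} → C_{1→j}, and a unitary U': A₂⊗…⊗A_n → C'₁⊗…⊗C'_m, such that U = (⊗_{j=1}^m U_{1→j}) ⊗ U', and moreover U' is again a minimally I₃-scrambling MIMO unitary. -/

import Mathlib

open Matrix Filter
open scoped BigOperators Classical ComplexOrder

noncomputable section

universe u

namespace Scrambling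

/-- A (possibly rectangular) matrix is unitary if `U Uᴴ = 1` and `Uᴴ U = 1`. -/
def IsUnitaryMat {m n : Type*} [Fintype m] [Fintype n] [DecidableEq m] [DecidableEq n]
    (U : Matrix m n ℂ) : Prop :=
  U * Uᴴ = 1 ∧ Uᴴ * U = 1

/-- Base-2 von Neumann entropy of a (Hermitian) matrix. -/
def vNE {n : Type*} [Fintype n] [DecidableEq n] (ρ : Matrix n n ℂ) : ℝ :=
  if h : ρ.IsHermitian then (∑ i, Real.negMulLog (h.eigenvalues i)) / Real.log 2 else 0

instance sumElimFintype {I J : Type*} {FA : I → Type u} {FC : J → Type u}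
    [∀ i, Fintype (FA i)] [∀ j, Fintype (FC j)] : ∀ k : I ⊕ J, Fintype (Sum.elim FA FC k)
  | Sum.inl i => inferInstanceAs (Fintype (FA i))
  | Sum.inr j => inferInstanceAs (Fintype (FC j))

instance sumElimDecEq {I J : Type*} {FA : I → Type u} {FC : J → Type u}
    [∀ i, DecidableEq (FA i)] [∀ j, DecidableEq (FC j)] :
    ∀ k : I ⊕ J, DecidableEq (Sum.elim FA FC k)
  | Sum.inl i => inferInstanceAs (DecidableEq (FA i))
  | Sum.inr j => inferInstanceAs (DecidableEq (FC j))

section Marginals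

variable {K : Type*} [Fintype K] [DecidableEq K] {F : K → Type*}
  [∀ k, Fintype (F k)] [∀ k, DecidableEq (F k)]

/-- Marginal density matrix of the pure state `ψ` on the subsystems in `S`,
obtained by tracing out the subsystems in the complement of `S`. -/
def marg (S : Finset K) (ψ : (∀ k, F k) → ℂ) :
    Matrix (∀ k : {a // a ∈ S}, F k.val) (∀ k : {a // a ∈ S}, F k.val) ℂ :=
  Matrix.of fun x x' =>
    ∑ y : ∀ k : {a // a ∈ Sᶜ}, F k.val,
      ψ (fun k => if h : k ∈ S then x ⟨k, h⟩ else y ⟨k, Finset.mem_compl.mpr h⟩) *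
      star (ψ (fun k => if h : k ∈ S then x' ⟨k, h⟩ else y ⟨k, Finset.mem_compl.mpr h⟩))

/-- Entropy of the subsystems in `S` for the multipartite pure state `ψ`. -/
def Sm (S : Finset K) (ψ : (∀ k, F k) → ℂ) : ℝ := vNE (marg S ψ)

/-- Mutual information `I(X;Y)` between two disjoint collections of subsystems. -/
def Im (X Y : Finset K) (ψ : (∀ k, F k) → ℂ) : ℝ :=
  Sm X ψ + Sm Y ψ - Sm (X ∪ Y) ψ

/-- Tripartite information `I₃(X;Y;Z) = I(X;Y) + I(X;Z) - I(X;YZ)`. -/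
def I3m (X Y Z : Finset K) (ψ : (∀ k, F k) → ℂ) : ℝ :=
  Im X Y ψ + Im X Z ψ - Im X (Y ∪ Z) ψ

end Marginals

/-- The Choi state vector of a MIMO unitary `U : A₁ ⊗ ⋯ ⊗ A_n → C₁ ⊗ ⋯ ⊗ C_m`,
obtained by feeding one half of a maximally entangled state into each input. -/
def mChoi {I J : Type*} [Fintype I] [Fintype J] {FA : I → Type u} {FC : J → Type u}
    [∀ i, Fintype (FA i)]
    (U : Matrix (∀ j, FC j) (∀ i, FA i) ℂ) :
    (∀ k : I ⊕ J, Sum.elim FA FC k) → ℂ :=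
  fun h => (Real.sqrt (Fintype.card (∀ i, FA i)) : ℂ)⁻¹ *
    U (fun j => h (Sum.inr j)) (fun i => h (Sum.inl i))

/-- A MIMO unitary is minimally I₃-scrambling if `I₃(A_i; A_i^c; C_j) = 0`
for all inputs `A_i` and outputs `C_j`. -/
def MinScrambling {I J : Type*} [Fintype I] [Fintype J] [DecidableEq I] [DecidableEq J]
    {FA : I → Type u} {FC : J → Type u}
    [∀ i, Fintype (FA i)] [∀ j, Fintype (FC j)]
    [∀ i, DecidableEq (FA i)] [∀ j, DecidableEq (FC j)]
    (U : Matrix (∀ j, FC j) (∀ i, FA i) ℂ) : Prop :=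
  ∀ (i : I) (j : J),
    I3m ({Sum.inl i} : Finset (I ⊕ J)) ((Finset.univ.erase i).image Sum.inl)
      ({Sum.inr j} : Finset (I ⊕ J)) (mChoi U) = 0


/-- Basis change on the first input: `A₁ ≅ ⊗ⱼ A_{1→j}`, tensored with the identity on the
remaining inputs. -/
def bigVpeel {n m : ℕ} {dA : Fin (n + 1) → ℕ} {e : Fin m → ℕ}
    (V : Matrix (∀ j, Fin (e j)) (Fin (dA 0)) ℂ) :
    Matrix ((∀ j, Fin (e j)) × (∀ i : Fin n, Fin (dA i.succ))) (∀ i, Fin (dA i)) ℂ :=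
  Matrix.of fun p x =>
    V p.1 (x 0) * (if (fun i : Fin n => x i.succ) = p.2 then 1 else 0)

/-- Basis changes on the outputs: `C_j ≅ C_{1→j} ⊗ C'_j`. -/
def bigWpair {m : ℕ} {dC : Fin m → ℕ} {e e' : Fin m → ℕ}
    (W : ∀ j, Matrix (Fin (e j) × Fin (e' j)) (Fin (dC j)) ℂ) :
    Matrix (∀ j, Fin (e j) × Fin (e' j)) (∀ j, Fin (dC j)) ℂ :=
  Matrix.of fun g y => ∏ j, W j (g j) (y j)

theorem vNE_roots {n : Type*} [Fintype n] [DecidableEq n] {ρ : Matrix n n ℂ} (h : ρ.IsHermitian) :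
    vNE ρ = (ρ.charpoly.roots.map (fun z => Real.negMulLog z.re)).sum / Real.log 2 := by
  unfold vNE
  rw [dif_pos h, h.roots_charpoly_eq_eigenvalues, Multiset.map_map]
  rfl

theorem vNE_mul_comm {m n : Type*} [Fintype m] [DecidableEq m] [Fintype n] [DecidableEq n]
    (A : Matrix m n ℂ) (B : Matrix n m ℂ) (h1 : (A * B).IsHermitian) (h2 : (B * A).IsHermitian) :
    vNE (A * B) = vNE (B * A) := by
  rw [vNE_roots h1, vNE_roots h2]
  have h := congrArg Polynomial.roots (Matrix.charpoly_mul_comm' A B)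
  rw [Polynomial.roots_mul (mul_ne_zero (pow_ne_zero _ Polynomial.X_ne_zero)
      (Matrix.charpoly_monic _).ne_zero),
    Polynomial.roots_mul (mul_ne_zero (pow_ne_zero _ Polynomial.X_ne_zero)
      (Matrix.charpoly_monic _).ne_zero), Polynomial.roots_X_pow, Polynomial.roots_X_pow] at h
  have h' := congrArg (fun s : Multiset ℂ => (s.map (fun z => Real.negMulLog z.re)).sum) h
  simp [Multiset.map_nsmul, Multiset.sum_nsmul] at h'
  rw [h']

theorem vNE_diagonal {n : Type*} [Fintype n] [DecidableEq n] (l : n → ℝ) :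
    vNE (diagonal (fun i => (l i : ℂ))) = (∑ i, Real.negMulLog (l i)) / Real.log 2 := by
  have h : (diagonal (fun i => (l i : ℂ))).IsHermitian := by
    rw [Matrix.IsHermitian, diagonal_conjTranspose]
    congr 1; ext i; simp
  rw [vNE_roots h, charpoly_diagonal, Polynomial.roots_prod]
  · simp
  · simp [Finset.prod_ne_zero_iff, Polynomial.X_sub_C_ne_zero]

theorem vNE_conj {n k : Type*} [Fintype n] [DecidableEq n] [Fintype k] [DecidableEq k]
    (Q : Matrix n k ℂ) (hQ : Qᴴ * Q = 1) (D : Matrix k k ℂ) (hD : D.IsHermitian) :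
    vNE (Q * D * Qᴴ) = vNE D := by
  have e : D * Qᴴ * Q = D := by rw [Matrix.mul_assoc, hQ, Matrix.mul_one]
  rw [Matrix.mul_assoc, vNE_mul_comm, e]
  · rw [← Matrix.mul_assoc]; exact isHermitian_mul_mul_conjTranspose _ hD
  · rw [e]; exact hD

theorem vNE_transpose {n : Type*} [Fintype n] [DecidableEq n] (D : Matrix n n ℂ)
    (hD : D.IsHermitian) : vNE Dᵀ = vNE D := by
  rw [vNE_roots hD, vNE_roots hD.transpose, charpoly_transpose]

theorem vNE_compl {m n : Type*} [Fintype m] [DecidableEq m] [Fintype n] [DecidableEq n]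
    (M : Matrix m n ℂ) : vNE (M * Mᴴ) = vNE (Mᵀ * Mᵀᴴ) := by
  rw [vNE_mul_comm _ _ (isHermitian_mul_conjTranspose_self M) (isHermitian_conjTranspose_mul_self M),
    ← vNE_transpose _ (isHermitian_conjTranspose_mul_self M), transpose_mul]
  rfl

theorem vNE_submatrix {m n : Type*} [Fintype m] [DecidableEq m] [Fintype n] [DecidableEq n]
    (e : m ≃ n) (D : Matrix n n ℂ) (hD : D.IsHermitian) : vNE (D.submatrix e e) = vNE D := by
  rw [vNE_roots hD, vNE_roots (hD.submatrix e)]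
  have := charpoly_reindex e.symm D
  rw [← this]; rfl

theorem spectral {n : Type*} [Fintype n] [DecidableEq n] {ρ : Matrix n n ℂ} (h : ρ.IsHermitian) :
    ∃ (Q : Matrix n n ℂ) (l : n → ℝ), Q * Qᴴ = 1 ∧ Qᴴ * Q = 1 ∧
      ρ = Q * diagonal (fun i => (l i : ℂ)) * Qᴴ ∧
      vNE ρ = (∑ i, Real.negMulLog (l i)) / Real.log 2 := by
  refine ⟨h.eigenvectorUnitary, h.eigenvalues, ?_, ?_, ?_, ?_⟩
  · exact Unitary.coe_mul_star_self h.eigenvectorUnitary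
  · exact Unitary.coe_star_mul_self h.eigenvectorUnitary
  · exact h.spectral_theorem
  · unfold vNE; rw [dif_pos h]

theorem vNE_flat {n : Type*} [Fintype n] [DecidableEq n] [Nonempty n] {ρ : Matrix n n ℂ}
    (h : ρ = ((Fintype.card n : ℂ)⁻¹) • (1 : Matrix n n ℂ)) :
    vNE ρ = Real.log (Fintype.card n) / Real.log 2 := by
  have : ρ = diagonal (fun _ => (((Fintype.card n : ℝ)⁻¹ : ℝ) : ℂ)) := by
    rw [h, smul_one_eq_diagonal]; simp
  rw [this, vNE_diagonal]
  have hc : (Fintype.card n : ℝ) ≠ 0 := by simp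
  simp [Real.negMulLog]

theorem vNE_kron {f n : Type*} [Fintype f] [DecidableEq f] [Nonempty f] [Fintype n] [DecidableEq n]
    {ρ : Matrix n n ℂ} (h : ρ.IsHermitian) (ht : ρ.trace = 1) :
    vNE (Matrix.of fun (p q : f × n) =>
      (if p.1 = q.1 then (Fintype.card f : ℂ)⁻¹ else 0) * ρ p.2 q.2) =
      vNE ρ + Real.log (Fintype.card f) / Real.log 2 := by
  obtain ⟨Q, l, h1, h2, h3, h4⟩ := spectral h
  have hl : ∑ i, l i = 1 := by
    rw [h3, trace_mul_comm, ← Matrix.mul_assoc, h2, Matrix.one_mul, trace_diagonal] at ht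
    exact_mod_cast ht
  have hQ : ((1 : Matrix f f ℂ).kronecker Q)ᴴ * ((1 : Matrix f f ℂ).kronecker Q) = 1 := by
    rw [Matrix.kronecker, conjTranspose_kronecker, ← mul_kronecker_mul, h2]; simp
  have : (Matrix.of fun (p q : f × n) =>
      (if p.1 = q.1 then (Fintype.card f : ℂ)⁻¹ else 0) * ρ p.2 q.2) =
      ((1 : Matrix f f ℂ).kronecker Q) *
        (diagonal (fun p : f × n => (((Fintype.card f : ℝ)⁻¹ * l p.2 : ℝ) : ℂ)))
        * ((1 : Matrix f f ℂ).kronecker Q)ᴴ := by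
    have e1 : (diagonal (fun p : f × n => (((Fintype.card f : ℝ)⁻¹ * l p.2 : ℝ) : ℂ))) =
      (((Fintype.card f : ℂ)⁻¹) • (1 : Matrix f f ℂ)).kronecker (diagonal (fun i => (l i : ℂ))) := by
      rw [smul_one_eq_diagonal, Matrix.kronecker, diagonal_kronecker_diagonal]
      simp
    rw [e1]; unfold Matrix.kronecker; rw [conjTranspose_kronecker, ← mul_kronecker_mul,
      ← mul_kronecker_mul, ← h3]
    ext p q
    simp [Matrix.one_apply]
  rw [this, vNE_conj _ hQ, vNE_diagonal, h4, Fintype.sum_prod_type]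
  · have hc : (Fintype.card f : ℝ) ≠ 0 := by simp
    have : ∀ x, Real.negMulLog ((Fintype.card f : ℝ)⁻¹ * x) =
       (Fintype.card f : ℝ)⁻¹ * (Real.negMulLog x + x * Real.log (Fintype.card f)) := by
      intro x
      rw [Real.negMulLog_mul]
      simp [Real.negMulLog]; ring
    simp only [this, Finset.sum_const, Finset.card_univ, ← Finset.mul_sum, Finset.sum_add_distrib,
      ← Finset.sum_mul, hl]
    simp
    field_simp
  · rw [Matrix.IsHermitian, diagonal_conjTranspose]
    congr 1; ext i; simp

theorem scalar_key {α β : Type*} [Fintype α] [Fintype β] (x : α → ℝ) (y : β → ℝ)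
    (hx : ∀ i, 0 ≤ x i) (hy : ∀ j, 0 ≤ y j) (sx : ∑ i, x i = 1) (sy : ∑ j, y j = 1)
    (c d : ℝ) (hc : 0 < c) (hd : 0 < d)
    (hent : ∑ i, Real.negMulLog (x i) + ∑ j, Real.negMulLog (y j) = Real.log (c * d))
    (hg : ∀ t > 0, 0 ≤ ∑ j, y j / (d * y j + t) - ∑ i, c * x i ^ 2 / (1 + c * t * x i)) :
    ∀ t > 0, ∑ j, y j / (d * y j + t) - ∑ i, c * x i ^ 2 / (1 + c * t * x i) = 0 := by
  set G : ℝ → ℝ := fun t => ∑ j, y j * Real.log (d * y j + t) -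
    ∑ i, x i * (Real.log (1 + c * t * x i) - Real.log (c * x i)) with hG
  have hder : ∀ t > 0, HasDerivAt G
      (∑ j, y j / (d * y j + t) - ∑ i, c * x i ^ 2 / (1 + c * t * x i)) t := by
    intro t ht
    refine HasDerivAt.sub (HasDerivAt.fun_sum fun j _ => ?_) (HasDerivAt.fun_sum fun i _ => ?_)
    · have h1 : d * y j + t ≠ 0 := by have := mul_nonneg hd.le (hy j); positivity
      have h0 : HasDerivAt (fun t => d * y j + t) 1 t := (hasDerivAt_id t).const_add (d * y j)
      have := (h0.log h1).const_mul (y j)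
      rw [div_eq_mul_one_div]
      exact this
    · have h1 : 1 + c * t * x i ≠ 0 := by have := hx i; positivity
      have h0 : HasDerivAt (fun t => 1 + c * t * x i) (c * x i) t := by
        have := (((hasDerivAt_id t).const_mul c).mul_const (x i)).const_add 1
        simpa using this
      have := ((h0.log h1).sub_const (Real.log (c * x i))).const_mul (x i)
      have e : c * x i ^ 2 / (1 + c * t * x i) = x i * (c * x i / (1 + c * t * x i)) := by ring
      rw [e]
      exact this
  have hcont : ContinuousOn G (Set.Ici 0) := by
    refine ContinuousOn.sub (continuousOn_finsetSum _ fun j _ => ?_)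
      (continuousOn_finsetSum _ fun i _ => ?_)
    · rcases (hy j).eq_or_lt with h | h
      · simp [← h, continuousOn_const]
      · refine continuousOn_const.mul (ContinuousOn.log (by fun_prop) ?_)
        intro t ht
        have : 0 ≤ t := ht
        positivity
    · refine continuousOn_const.mul (ContinuousOn.sub (ContinuousOn.log (by fun_prop) ?_)
        continuousOn_const)
      intro t ht
      have : 0 ≤ t := ht
      have := hx i
      positivity
  have hmono : MonotoneOn G (Set.Ici 0) := by
    refine monotoneOn_of_deriv_nonneg (convex_Ici 0) hcont ?_ ?_
    · intro t ht
      rw [interior_Ici] at ht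
      exact (hder t ht).differentiableAt.differentiableWithinAt
    · intro t ht
      rw [interior_Ici] at ht
      rw [(hder t ht).deriv]
      exact hg t ht
  have hG0 : G 0 = 0 := by
    have e1 : ∀ j, y j * Real.log (d * y j) = y j * Real.log d - Real.negMulLog (y j) := by
      intro j
      rcases (hy j).eq_or_lt with h | h
      · simp [← h]
      · rw [Real.log_mul hd.ne' h.ne', Real.negMulLog]; ring
    have e2 : ∀ i, x i * Real.log (c * x i) = x i * Real.log c - Real.negMulLog (x i) := by
      intro j
      rcases (hx j).eq_or_lt with h | h
      · simp [← h]
      · rw [Real.log_mul hc.ne' h.ne', Real.negMulLog]; ring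
    simp only [hG, add_zero, mul_zero, zero_mul, Real.log_one, zero_sub, mul_neg,
      Finset.sum_neg_distrib, e1, e2, Finset.sum_sub_distrib, ← Finset.sum_mul, sx, sy]
    rw [Real.log_mul hc.ne' hd.ne'] at hent
    linarith
  have hlim : Tendsto G atTop (nhds 0) := by
    have hinv : Tendsto (fun t : ℝ => t⁻¹) atTop (nhds 0) := tendsto_inv_atTop_zero
    have hlog : ∀ a : ℝ, Tendsto (fun t : ℝ => Real.log (1 + a * t⁻¹)) atTop (nhds 0) := by
      intro a
      have h1 : Tendsto (fun t : ℝ => 1 + a * t⁻¹) atTop (nhds (1 + a * 0)) :=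
        tendsto_const_nhds.add (tendsto_const_nhds.mul hinv)
      have := h1.log (by simp)
      simpa using this
    have hF : Tendsto (fun t : ℝ => ∑ j, y j * Real.log (1 + (d * y j) * t⁻¹)
        - ∑ i, x i * Real.log (1 + (c * x i)⁻¹ * t⁻¹)) atTop
        (nhds (∑ j, y j * 0 - ∑ i, x i * 0)) :=
      (tendsto_finsetSum _ fun j _ => (hlog _).const_mul _).sub
        (tendsto_finsetSum _ fun i _ => (hlog _).const_mul _)
    simp only [mul_zero, Finset.sum_const_zero, sub_zero] at hF
    refine hF.congr' ?_
    filter_upwards [eventually_gt_atTop 0] with t ht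
    have e1 : ∀ j, y j * Real.log (1 + (d * y j) * t⁻¹) =
        y j * Real.log (d * y j + t) - y j * Real.log t := by
      intro j
      have h1 : d * y j + t ≠ 0 := by have := mul_nonneg hd.le (hy j); positivity
      rw [← mul_sub, ← Real.log_div h1 ht.ne']
      congr 2
      field_simp
      ring
    have e2 : ∀ i, x i * Real.log (1 + (c * x i)⁻¹ * t⁻¹) =
        x i * (Real.log (1 + c * t * x i) - Real.log (c * x i)) - x i * Real.log t := by
      intro i
      rcases (hx i).eq_or_lt with h | h
      · simp [← h]
      have h1 : 1 + c * t * x i ≠ 0 := by positivity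
      rw [← mul_sub, ← Real.log_div h1 (by positivity), ← Real.log_div (by positivity) ht.ne']
      congr 2
      field_simp
      ring
    simp only [e1, e2, Finset.sum_sub_distrib, ← Finset.sum_mul, sx, sy, hG]
    ring
  have hzero : ∀ t > 0, G t = 0 := by
    intro t ht
    apply le_antisymm
    · refine ge_of_tendsto hlim ?_
      filter_upwards [eventually_ge_atTop t] with s hs
      exact hmono ht.le (ht.le.trans hs) hs
    · rw [← hG0]; exact hmono (Set.mem_Ici.2 le_rfl) ht.le ht.le
  intro t ht
  refine (hder t ht).unique ((hasDerivAt_const t (0:ℝ)).congr_of_eventuallyEq ?_)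
  filter_upwards [Ioi_mem_nhds ht] with s hs
  exact hzero s hs

/-- functional calculus helper -/
def fc {n : Type*} [Fintype n] [DecidableEq n] (Q : Matrix n n ℂ) (g : n → ℝ) : Matrix n n ℂ :=
  Q * diagonal (fun i => (g i : ℂ)) * Qᴴ

theorem fc_mul {n : Type*} [Fintype n] [DecidableEq n] {Q : Matrix n n ℂ} (hQ : Qᴴ * Q = 1)
    (g h : n → ℝ) : fc Q g * fc Q h = fc Q (fun i => g i * h i) := by
  unfold fc
  have : Q * diagonal (fun i => (g i : ℂ)) * Qᴴ * (Q * diagonal (fun i => (h i : ℂ)) * Qᴴ) =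
    Q * (diagonal (fun i => (g i : ℂ)) * (Qᴴ * Q) * diagonal (fun i => (h i : ℂ))) * Qᴴ := by
    simp only [Matrix.mul_assoc]
  rw [this, hQ, Matrix.mul_one, diagonal_mul_diagonal]
  simp

theorem fc_star {n : Type*} [Fintype n] [DecidableEq n] (Q : Matrix n n ℂ)
    (g : n → ℝ) : (fc Q g)ᴴ = fc Q g := by
  refine isHermitian_mul_mul_conjTranspose _ ?_
  rw [Matrix.IsHermitian, diagonal_conjTranspose]
  congr 1; ext i; simp

theorem fc_trace {n : Type*} [Fintype n] [DecidableEq n] {Q : Matrix n n ℂ} (hQ : Qᴴ * Q = 1)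
    (g : n → ℝ) : (fc Q g).trace = ((∑ i, g i : ℝ) : ℂ) := by
  unfold fc
  rw [trace_mul_comm, ← Matrix.mul_assoc, hQ, Matrix.one_mul, trace_diagonal]
  simp

theorem fc_one {n : Type*} [Fintype n] [DecidableEq n] {Q : Matrix n n ℂ} (hQ : Q * Qᴴ = 1) :
    fc Q (fun _ => 1) = 1 := by
  unfold fc
  simp [hQ]

theorem fc_lin {n : Type*} [Fintype n] [DecidableEq n] {Q : Matrix n n ℂ} (hQ : Q * Qᴴ = 1)
    (g : n → ℝ) (d t : ℝ) : fc Q (fun i => d * g i + t) = (d : ℂ) • fc Q g + (t : ℂ) • 1 := by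
  rw [← fc_one hQ]
  unfold fc
  have : diagonal (fun i => ((d * g i + t : ℝ) : ℂ)) = (d : ℂ) • diagonal (fun i => (g i : ℂ)) +
      (t : ℂ) • diagonal (fun _ : n => ((1 : ℝ) : ℂ)) := by
    ext i j
    by_cases h : i = j
    · subst h; simp
    · simp [h]
  rw [this, Matrix.mul_add, Matrix.add_mul]
  simp only [Matrix.mul_smul, Matrix.smul_mul]

theorem spectral_pos {n : Type*} [Fintype n] [DecidableEq n] {ρ : Matrix n n ℂ}
    (h : ρ.PosSemidef) :
    ∃ (Q : Matrix n n ℂ) (l : n → ℝ), Q * Qᴴ = 1 ∧ Qᴴ * Q = 1 ∧ (∀ i, 0 ≤ l i) ∧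
      ρ = fc Q l ∧
      vNE ρ = (∑ i, Real.negMulLog (l i)) / Real.log 2 := by
  refine ⟨h.1.eigenvectorUnitary, h.1.eigenvalues, ?_, ?_, h.eigenvalues_nonneg, ?_, ?_⟩
  · exact Unitary.coe_mul_star_self h.1.eigenvectorUnitary
  · exact Unitary.coe_star_mul_self h.1.eigenvectorUnitary
  · exact h.1.spectral_theorem
  · unfold vNE; rw [dif_pos h.1]

set_option maxHeartbeats 1000000 in
theorem markov_key {α β η : Type*} [Fintype α] [DecidableEq α] [Fintype β] [DecidableEq β]
    [Fintype η] [DecidableEq η] (X : Matrix α α ℂ) (Y : Matrix β β ℂ) (hX : X.PosSemidef)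
    (hY : Y.PosSemidef) (ι : Matrix α α ℂ →⋆ₐ[ℂ] Matrix η η ℂ)
    (κ : Matrix β β ℂ →⋆ₐ[ℂ] Matrix η η ℂ) (P : Matrix η η ℂ) (hP : P * P = P) (hPH : Pᴴ = P)
    (c d : ℝ) (hc : 0 < c) (hd : 0 < d)
    (h1 : ∀ M, trace (P * ι M) = d * trace (X * M))
    (h2 : ∀ M, trace (P * κ M) = d * trace (Y * M))
    (h3 : ∀ M, trace (ι M * κ Y) = (c : ℂ)⁻¹ * trace M)
    (trX : X.trace = 1) (trY : Y.trace = 1)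
    (hent : vNE X + vNE Y = Real.log (c * d) / Real.log 2) :
    κ Y * ι X = ((c : ℂ) * d)⁻¹ • P := by
  obtain ⟨Q, x, hQ1, hQ2, hx, hXQ, hXe⟩ := spectral_pos hX
  obtain ⟨R, y, hR1, hR2, hy, hYR, hYe⟩ := spectral_pos hY
  have sx : ∑ i, x i = 1 := by
    rw [hXQ, fc_trace hQ2] at trX; exact_mod_cast trX
  have sy : ∑ i, y i = 1 := by
    rw [hYR, fc_trace hR2] at trY; exact_mod_cast trY
  have hent' : ∑ i, Real.negMulLog (x i) + ∑ j, Real.negMulLog (y j) = Real.log (c * d) := by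
    rw [hXe, hYe, ← add_div] at hent
    have h2 : Real.log 2 ≠ 0 := by positivity
    field_simp at hent
    exact hent
  have istar : ∀ M, (ι M)ᴴ = ι Mᴴ := fun M => (map_star ι M).symm
  have kstar : ∀ M, (κ M)ᴴ = κ Mᴴ := fun M => (map_star κ M).symm
  set Ys := fc R (fun j => Real.sqrt (y j)) with hYs
  have hYY : Ys * Ys = Y := by
    rw [hYR, hYs, fc_mul hR2]; congr 1; ext j; exact Real.mul_self_sqrt (hy j)
  have main : ∀ t : ℝ, 0 < t → ∃ r : ℝ, 0 ≤ r ∧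
      ∑ j, y j / (d * y j + t) - ∑ i, c * x i ^ 2 / (1 + c * t * x i) = r ∧
      (r = 0 → ((d : ℂ) • κ Y + (t : ℂ) • 1) * ι (fc Q fun i => c * x i / (1 + c * t * x i)) * P = P
       ∧ κ Y * (ι (fc Q fun i => c * x i / (1 + c * t * x i)) * (1 - P)) = 0) := by
    intro t ht
    have hpos : ∀ j, 0 < d * y j + t := fun j => by have := mul_nonneg hd.le (hy j); positivity
    have hpos' : ∀ j, 0 < 1 + c * t * x j := fun j => by have := hx j; positivity
    set k := fc Q fun i => c * x i / (1 + c * t * x i) with hk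
    set Z := fc R fun j => (Real.sqrt (d * y j + t))⁻¹ with hZ
    set T := (d : ℂ) • κ Y + (t : ℂ) • (1 : Matrix η η ℂ) with hT
    have hTk : T = κ (fc R fun j => d * y j + t) := by
      rw [fc_lin hR1, ← hYR, map_add, map_smul, map_smul, map_one]
    set K := ι k with hK
    set S := κ (Z * Z) with hS
    have hST : S * T = 1 := by
      rw [hTk, hS, ← map_mul, fc_mul hR2, fc_mul hR2, ← map_one κ, ← fc_one hR1]
      congr 2; ext j
      have := Real.mul_self_sqrt (hpos j).le
      have h0 : Real.sqrt (d * y j + t) ≠ 0 := (Real.sqrt_pos.2 (hpos j)).ne'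
      field_simp
      nlinarith
    have hTS : T * S = 1 := mul_eq_one_comm.1 hST
    have hKH : Kᴴ = K := by rw [hK, istar, hk, fc_star]
    have hTH : Tᴴ = T := by rw [hTk, kstar, fc_star]
    have hZH : (κ Z)ᴴ = κ Z := by rw [kstar, hZ, fc_star]
    have hYsH : (κ Ys)ᴴ = κ Ys := by rw [kstar, hYs, fc_star]
    set W := P - T * K * P with hW
    set V := K * (1 - P) with hV
    have eW : (κ Z * W)ᴴ * (κ Z * W) = P * S * P - P * K * P - P * K * P +
        (d : ℂ) • (P * K * κ Y * K * P) + (t : ℂ) • (P * (K * K) * P) := by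
      have a1 : (κ Z * W)ᴴ * (κ Z * W) = (P - P * K * T) * S * (P - T * K * P) := by
        rw [conjTranspose_mul, hZH, hW, conjTranspose_sub, conjTranspose_mul, conjTranspose_mul,
          hKH, hTH, hPH, hS, map_mul]
        simp only [Matrix.mul_assoc]
      have a2 : (P - P * K * T) * S * (P - T * K * P) =
        P * S * P - P * K * (T * S) * P - P * (S * T) * K * P + P * K * (T * S) * T * K * P := by
        noncomm_ring
      rw [a1, a2, hTS, hST, hT]
      simp only [Matrix.mul_one, Matrix.mul_add, Matrix.add_mul, Matrix.mul_smul, Matrix.smul_mul,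
        Matrix.mul_assoc]
      abel
    have eV : (κ Ys * V)ᴴ * (κ Ys * V) = (1 - P) * (K * κ Y * K) * (1 - P) := by
      rw [conjTranspose_mul, hYsH, hV, conjTranspose_mul, conjTranspose_sub, hKH, hPH,
        conjTranspose_one, ← hYY, map_mul]
      simp only [Matrix.mul_assoc]
    have cyc : ∀ M : Matrix η η ℂ, trace (P * M * P) = trace (P * M) := by
      intro M; rw [trace_mul_comm, ← Matrix.mul_assoc, hP]
    have tW : trace ((κ Z * W)ᴴ * (κ Z * W)) = trace (P * S) - 2 * trace (P * K) +
        d * trace (P * (K * κ Y * K)) + t * trace (P * (K * K)) := by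
      rw [eW]
      simp only [trace_add, trace_sub, trace_smul, smul_eq_mul]
      have : P * K * κ Y * K * P = P * (K * κ Y * K) * P := by simp only [Matrix.mul_assoc]
      rw [this]
      simp only [cyc]; ring
    have hP1 : (1 - P) * (1 - P) = 1 - P := by
      simp [Matrix.mul_sub, Matrix.sub_mul, hP]
    have tV : trace ((κ Ys * V)ᴴ * (κ Ys * V)) = trace (K * K * κ Y) -
        trace (P * (K * κ Y * K)) := by
      rw [eV, trace_mul_comm, ← Matrix.mul_assoc, hP1, Matrix.sub_mul, Matrix.one_mul, trace_sub,
        trace_mul_comm, ← Matrix.mul_assoc]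
    have n1 := (posSemidef_conjTranspose_mul_self (κ Z * W)).trace_nonneg
    have n2 := (posSemidef_conjTranspose_mul_self (κ Ys * V)).trace_nonneg
    have tot : trace ((κ Z * W)ᴴ * (κ Z * W)) + d * trace ((κ Ys * V)ᴴ * (κ Ys * V)) =
        ((d * (∑ j, y j / (d * y j + t) - ∑ i, c * x i ^ 2 / (1 + c * t * x i)) : ℝ) : ℂ) := by
      rw [tW, tV]
      have b1 : trace (P * S) = ((d * ∑ j, y j / (d * y j + t) : ℝ) : ℂ) := by
        rw [hS, h2, hYR, hZ, fc_mul hR2, fc_mul hR2, fc_trace hR2]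
        push_cast
        congr 1
        refine Finset.sum_congr rfl fun j _ => ?_
        have := Real.mul_self_sqrt (hpos j).le
        norm_cast
        rw [← mul_inv, this]; rfl
      have b2 : trace (P * K) = ((d * ∑ i, x i * (c * x i / (1 + c * t * x i)) : ℝ) : ℂ) := by
        rw [hK, h1, hXQ, hk, fc_mul hQ2, fc_trace hQ2]
        push_cast; rfl
      have b3 : trace (P * (K * K)) = ((d * ∑ i, x i * ((c * x i / (1 + c * t * x i)) *
          (c * x i / (1 + c * t * x i))) : ℝ) : ℂ) := by
        rw [hK, ← map_mul, h1, hXQ, hk, fc_mul hQ2, fc_mul hQ2, fc_trace hQ2]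
        push_cast; rfl
      have b4 : trace (K * K * κ Y) = ((c⁻¹ * ∑ i, ((c * x i / (1 + c * t * x i)) *
          (c * x i / (1 + c * t * x i))) : ℝ) : ℂ) := by
        rw [hK, ← map_mul, h3, hk, fc_mul hQ2, fc_trace hQ2]
        push_cast; rfl
      rw [b1, b2, b3, b4]
      have key : -2 * ∑ i, x i * (c * x i / (1 + c * t * x i)) + c⁻¹ * ∑ i, ((c * x i /
          (1 + c * t * x i)) * (c * x i / (1 + c * t * x i))) + t * ∑ i, x i *
          ((c * x i / (1 + c * t * x i)) * (c * x i / (1 + c * t * x i))) =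
          - ∑ i, c * x i ^ 2 / (1 + c * t * x i) := by
        rw [Finset.mul_sum, Finset.mul_sum, Finset.mul_sum, ← Finset.sum_add_distrib,
          ← Finset.sum_add_distrib, ← Finset.sum_neg_distrib]
        refine Finset.sum_congr rfl fun i _ => ?_
        have h0 := (hpos' i).ne'
        have e : c * x i ^ 2 / (1 + c * t * x i) = x i * (c * x i / (1 + c * t * x i)) := by ring
        rw [e]
        have hq : (c * x i / (1 + c * t * x i)) * (1 + c * t * x i) = c * x i :=
          div_mul_cancel₀ _ h0
        generalize c * x i / (1 + c * t * x i) = q at hq ⊢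
        have hcc : c⁻¹ * c = 1 := inv_mul_cancel₀ hc.ne'
        linear_combination c⁻¹ * q * hq + (q * x i - q * q * x i * t) * hcc
      have key' := congrArg (fun r : ℝ => ((d * r : ℝ) : ℂ)) key
      push_cast at key' ⊢
      linear_combination key'
    obtain ⟨r1, hr1, e1⟩ : ∃ r : ℝ, 0 ≤ r ∧ trace ((κ Z * W)ᴴ * (κ Z * W)) = r := by
      obtain ⟨r, hr, h⟩ := RCLike.nonneg_iff_exists_ofReal.1 n1
      exact ⟨r, hr, h.symm⟩
    obtain ⟨r2, hr2, e2⟩ : ∃ r : ℝ, 0 ≤ r ∧ trace ((κ Ys * V)ᴴ * (κ Ys * V)) = r := by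
      obtain ⟨r, hr, h⟩ := RCLike.nonneg_iff_exists_ofReal.1 n2
      exact ⟨r, hr, h.symm⟩
    rw [e1, e2] at tot
    have tot' : r1 + d * r2 = d * (∑ j, y j / (d * y j + t) -
      ∑ i, c * x i ^ 2 / (1 + c * t * x i)) := by exact_mod_cast tot
    refine ⟨_, ?_, rfl, ?_⟩
    · have : 0 ≤ d * (∑ j, y j / (d * y j + t) -
        ∑ i, c * x i ^ 2 / (1 + c * t * x i)) := by rw [← tot']; positivity
      exact nonneg_of_mul_nonneg_right this hd
    · intro h0
      rw [h0, mul_zero] at tot'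
      have r1z : r1 = 0 := by nlinarith [mul_nonneg hd.le hr2]
      have r2z : r2 = 0 := by
        rw [r1z, zero_add] at tot'
        exact (mul_eq_zero.1 tot').resolve_left hd.ne'
      rw [r1z, Complex.ofReal_zero, trace_conjTranspose_mul_self_eq_zero_iff] at e1
      rw [r2z, Complex.ofReal_zero, trace_conjTranspose_mul_self_eq_zero_iff] at e2
      constructor
      · have : S * W = 0 := by rw [hS, map_mul, Matrix.mul_assoc, e1, Matrix.mul_zero]
        have : T * S * W = 0 := by rw [Matrix.mul_assoc, this, Matrix.mul_zero]
        rw [hTS, Matrix.one_mul, hW, sub_eq_zero] at this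
        exact this.symm
      · rw [← hYY, map_mul, Matrix.mul_assoc, e2, Matrix.mul_zero]
  have hz := scalar_key x y hx hy sx sy c d hc hd hent' (fun t ht => by
    obtain ⟨r, hr, e, _⟩ := main t ht
    rw [e]; exact hr)
  have main2 : ∀ t : ℝ, 0 < t → ((d : ℂ) • κ Y + (t : ℂ) • 1) *
      ι (fc Q fun i => c * x i / (1 + c * t * x i)) * P = P
       ∧ κ Y * (ι (fc Q fun i => c * x i / (1 + c * t * x i)) * (1 - P)) = 0 := by
    intro t ht
    obtain ⟨r, hr, e, h⟩ := main t ht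
    exact h (by rw [← e]; exact hz t ht)
  -- limit
  have hKc : Tendsto (fun t : ℝ => ι (fc Q fun i => c * x i / (1 + c * t * x i)))
      (nhdsWithin 0 (Set.Ioi 0)) (nhds (ι ((c : ℂ) • X))) := by
    have hcι : Continuous ι := LinearMap.continuous_of_finiteDimensional (ι : Matrix α α ℂ →ₐ[ℂ] Matrix η η ℂ).toLinearMap
    have e0 : (c : ℂ) • X = fc Q (fun i => c * x i / (1 + c * 0 * x i)) := by
      have := fc_lin hQ1 x c 0
      rw [hXQ]
      simp at this ⊢
      exact this.symm
    rw [e0]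
    refine (hcι.tendsto _).comp ?_
    have hcont : ContinuousAt (fun t : ℝ => fc Q fun i => c * x i / (1 + c * t * x i)) 0 := by
      unfold fc
      have : ContinuousAt (fun t : ℝ => (diagonal (fun i =>
          ((c * x i / (1 + c * t * x i) : ℝ) : ℂ)) : Matrix α α ℂ)) 0 := by
        refine Continuous.matrix_diagonal continuous_id |>.continuousAt.comp ?_
        refine continuousAt_pi.2 fun i => ?_
        refine Complex.continuous_ofReal.continuousAt.comp ?_
        refine ContinuousAt.div (by fun_prop) (by fun_prop) (by simp)
      exact (continuousAt_const.mul this).mul continuousAt_const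
    exact hcont.tendsto.mono_left nhdsWithin_le_nhds
  have ht0 : Tendsto (fun t : ℝ => (t : ℂ)) (nhdsWithin 0 (Set.Ioi 0)) (nhds 0) := by
    have := (Complex.continuous_ofReal.tendsto 0).mono_left (nhdsWithin_le_nhds (s := Set.Ioi (0:ℝ)))
    simpa using this
  have L1 : ((d : ℂ) • κ Y + (0 : ℂ) • 1) * ι ((c : ℂ) • X) * P = P := by
    have h : Tendsto (fun t : ℝ => ((d : ℂ) • κ Y + (t : ℂ) • 1) *
      ι (fc Q fun i => c * x i / (1 + c * t * x i)) * P) (nhdsWithin 0 (Set.Ioi 0))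
      (nhds (((d : ℂ) • κ Y + (0 : ℂ) • 1) * ι ((c : ℂ) • X) * P)) :=
      ((tendsto_const_nhds.add (ht0.smul_const _)).mul hKc).mul tendsto_const_nhds
    refine tendsto_nhds_unique h (tendsto_const_nhds.congr' ?_)
    filter_upwards [self_mem_nhdsWithin] with t ht
    exact (main2 t ht).1.symm
  have L2 : κ Y * (ι ((c : ℂ) • X) * (1 - P)) = 0 := by
    have h : Tendsto (fun t : ℝ => κ Y *
      (ι (fc Q fun i => c * x i / (1 + c * t * x i)) * (1 - P))) (nhdsWithin 0 (Set.Ioi 0))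
      (nhds (κ Y * (ι ((c : ℂ) • X) * (1 - P)))) :=
      tendsto_const_nhds.mul (hKc.mul tendsto_const_nhds)
    refine tendsto_nhds_unique h (tendsto_const_nhds.congr' ?_)
    filter_upwards [self_mem_nhdsWithin] with t ht
    exact (main2 t ht).2.symm
  have hc' : (c : ℂ) ≠ 0 := by exact_mod_cast hc.ne'
  have hd' : (d : ℂ) ≠ 0 := by exact_mod_cast hd.ne'
  simp only [map_smul, zero_smul, add_zero, Matrix.smul_mul, Matrix.mul_smul, smul_smul,
    Matrix.mul_sub, Matrix.mul_one] at L1 L2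
  rw [sub_eq_zero] at L2
  have L2' : κ Y * ι X = κ Y * (ι X * P) := smul_right_injective _ hc' L2
  rw [L2', ← Matrix.mul_assoc]
  conv_rhs => rw [← L1]
  rw [smul_smul, inv_mul_cancel₀ (mul_ne_zero hc' hd'), one_smul]

/-- lift along an equivalence -/
def lft {x y η : Type*} [Fintype x] [DecidableEq x] [Fintype y] [DecidableEq y] [Fintype η]
    [DecidableEq η] (e : x × y ≃ η) : Matrix x x ℂ →⋆ₐ[ℂ] Matrix η η ℂ where
  toFun M := (Matrix.kroneckerMap (· * ·) M (1 : Matrix y y ℂ)).submatrix e.symm e.symm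
  map_one' := by
    rw [Matrix.kroneckerMap_one_one _ (by simp) (by simp) (by simp)]; simp
  map_mul' M N := by
    rw [Matrix.submatrix_mul_equiv]
    congr 1
    have := Matrix.mul_kronecker_mul M N (1 : Matrix y y ℂ) (1 : Matrix y y ℂ)
    simpa using this
  map_zero' := by ext; simp
  map_add' M N := by ext; simp [add_mul]
  commutes' r := by
    ext i j
    simp only [Matrix.algebraMap_eq_diagonal, Matrix.submatrix_apply, Matrix.kroneckerMap_apply,
      Matrix.diagonal_apply, Matrix.one_apply, Pi.algebraMap_apply]
    by_cases h : i = j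
    · simp [h]
    · have : e.symm i ≠ e.symm j := fun h' => h (e.symm.injective h')
      rw [if_neg h]
      by_cases h1 : (e.symm i).1 = (e.symm j).1
      · have : (e.symm i).2 ≠ (e.symm j).2 := fun h' => this (Prod.ext h1 h')
        simp [this]
      · simp [h1]
  map_star' M := by
    ext i j
    simp only [Matrix.submatrix_apply, Matrix.kroneckerMap_apply, Matrix.star_apply,
      Matrix.one_apply, star_mul']
    by_cases h : (e.symm i).2 = (e.symm j).2
    · simp [h]
    · simp [h, Ne.symm h]

theorem lft_apply {x y η : Type*} [Fintype x] [DecidableEq x] [Fintype y] [DecidableEq y]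
    [Fintype η] [DecidableEq η] (e : x × y ≃ η) (M : Matrix x x ℂ) (i j : η) :
    lft e M i j = M (e.symm i).1 (e.symm j).1 * (if (e.symm i).2 = (e.symm j).2 then 1 else 0) := by
  change M _ _ * (1 : Matrix y y ℂ) _ _ = _
  rw [Matrix.one_apply]

theorem lft_trace {x y η : Type*} [Fintype x] [DecidableEq x] [Fintype y] [DecidableEq y]
    [Fintype η] [DecidableEq η] (e : x × y ≃ η) (M : Matrix x x ℂ) (P : Matrix η η ℂ) :
    trace (P * lft e M) = trace ((Matrix.of fun p q => ∑ r, P (e (p, r)) (e (q, r))) * M) := by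
  simp only [Matrix.trace, Matrix.diag, Matrix.mul_apply, Matrix.of_apply, lft_apply]
  rw [← e.sum_comp]
  conv_lhs =>
    enter [2, i]
    rw [← e.sum_comp]
  simp only [Equiv.symm_apply_apply, Fintype.sum_prod_type,
    Finset.sum_mul]
  refine Finset.sum_congr rfl fun p _ => ?_
  rw [Finset.sum_comm]
  refine Finset.sum_congr rfl fun q _ => ?_
  refine Finset.sum_congr rfl fun r _ => ?_
  simp

theorem tens {α β γ δ : Type*} [Fintype α] [DecidableEq α] [Fintype β] [DecidableEq β]
    [Fintype γ] [DecidableEq γ] [Fintype δ] [DecidableEq δ] [Nonempty γ] [Nonempty δ]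
    (Ψ : α → β → γ → δ → ℂ)
    (hδ : ∀ d d', ∑ a, ∑ b, ∑ c, Ψ a b c d * star (Ψ a b c d') =
      if d = d' then (Fintype.card δ : ℂ)⁻¹ else 0)
    (hγ : ∀ c c', ∑ a, ∑ b, ∑ d, Ψ a b c d * star (Ψ a b c' d) =
      if c = c' then (Fintype.card γ : ℂ)⁻¹ else 0)
    (M1 : Matrix (α × γ) (β × δ) ℂ) (M2 : Matrix (β × γ) (α × δ) ℂ)
    (hM1 : M1 = Matrix.of fun p q => Ψ p.1 q.1 p.2 q.2)
    (hM2 : M2 = Matrix.of fun p q => Ψ q.1 p.1 p.2 q.2)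
    (hent : vNE (M1 * M1ᴴ) + vNE (M2 * M2ᴴ) =
      Real.log ((Fintype.card γ : ℝ) * (Fintype.card δ : ℝ)) / Real.log 2) (a a' b b' c c') :
    ∑ c1, (M2 * M2ᴴ) (b, c) (b', c1) * (M1 * M1ᴴ) (a, c1) (a', c') =
      (Fintype.card γ : ℂ)⁻¹ * ∑ d, Ψ a b c d * star (Ψ a' b' c' d) := by
  have hc : (0:ℝ) < Fintype.card γ := by exact_mod_cast Fintype.card_pos
  have hd : (0:ℝ) < Fintype.card δ := by exact_mod_cast Fintype.card_pos
  have hd' : (Fintype.card δ : ℂ) ≠ 0 := by exact_mod_cast hd.ne'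
  have hc' : (Fintype.card γ : ℂ) ≠ 0 := by exact_mod_cast hc.ne'
  set M : Matrix (α × β × γ) δ ℂ := Matrix.of fun p d => Ψ p.1 p.2.1 p.2.2 d with hM
  let e1 : (α × γ) × β ≃ α × β × γ :=
    ⟨fun p => (p.1.1, p.2, p.1.2), fun p => ((p.1, p.2.2), p.2.1), fun _ => rfl, fun _ => rfl⟩
  let e2 : (β × γ) × α ≃ α × β × γ :=
    ⟨fun p => (p.2, p.1.1, p.1.2), fun p => ((p.2.1, p.2.2), p.1), fun _ => rfl, fun _ => rfl⟩
  have hMM : Mᴴ * M = (Fintype.card δ : ℂ)⁻¹ • (1 : Matrix δ δ ℂ) := by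
    ext d d'
    have := hδ d' d
    simp only [hM, Matrix.mul_apply, Fintype.sum_prod_type, Matrix.conjTranspose_apply,
      Matrix.of_apply, Matrix.smul_apply, Matrix.one_apply, smul_eq_mul, mul_ite, mul_one, mul_zero]
    simp only [mul_comm (star _)]
    rw [this]
    simp [eq_comm]
  have H1 : ∀ N, trace (((Fintype.card δ : ℂ) • (M * Mᴴ)) * lft e1 N) =
      ((Fintype.card δ : ℝ) : ℂ) * trace ((M1 * M1ᴴ) * N) := by
    intro N
    rw [lft_trace]
    have : (Matrix.of fun p q => ∑ r, ((Fintype.card δ : ℂ) • (M * Mᴴ)) (e1 (p, r)) (e1 (q, r))) =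
        (Fintype.card δ : ℂ) • (M1 * M1ᴴ) := by
      ext p q
      simp only [hM, hM1, e1, Equiv.coe_fn_mk, Matrix.of_apply, Matrix.smul_apply,
        Matrix.mul_apply, Matrix.conjTranspose_apply, Fintype.sum_prod_type, smul_eq_mul,
        Finset.mul_sum]
    rw [this, Matrix.smul_mul, Matrix.trace_smul, smul_eq_mul]
    push_cast
    rfl
  have H2 : ∀ N, trace (((Fintype.card δ : ℂ) • (M * Mᴴ)) * lft e2 N) =
      ((Fintype.card δ : ℝ) : ℂ) * trace ((M2 * M2ᴴ) * N) := by
    intro N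
    rw [lft_trace]
    have : (Matrix.of fun p q => ∑ r, ((Fintype.card δ : ℂ) • (M * Mᴴ)) (e2 (p, r)) (e2 (q, r))) =
        (Fintype.card δ : ℂ) • (M2 * M2ᴴ) := by
      ext p q
      simp only [hM, hM2, e2, Equiv.coe_fn_mk, Matrix.of_apply, Matrix.smul_apply,
        Matrix.mul_apply, Matrix.conjTranspose_apply, Fintype.sum_prod_type, smul_eq_mul,
        Finset.mul_sum]
    rw [this, Matrix.smul_mul, Matrix.trace_smul, smul_eq_mul]
    push_cast
    rfl
  have trM : trace ((Fintype.card δ : ℂ) • (M * Mᴴ)) = Fintype.card δ := by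
    rw [Matrix.trace_smul, Matrix.trace_mul_comm, hMM]
    simp [hd']
  have tr1 : (M1 * M1ᴴ).trace = 1 := by
    have := H1 1
    rw [map_one, Matrix.mul_one, Matrix.mul_one, trM] at this
    push_cast at this
    exact mul_left_cancel₀ hd' (by rw [← this, mul_one])
  have tr2 : (M2 * M2ᴴ).trace = 1 := by
    have := H2 1
    rw [map_one, Matrix.mul_one, Matrix.mul_one, trM] at this
    push_cast at this
    exact mul_left_cancel₀ hd' (by rw [← this, mul_one])
  have hP : ((Fintype.card δ : ℂ) • (M * Mᴴ)) * ((Fintype.card δ : ℂ) • (M * Mᴴ)) =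
      (Fintype.card δ : ℂ) • (M * Mᴴ) := by
    rw [Matrix.smul_mul, Matrix.mul_smul, Matrix.mul_assoc M, ← Matrix.mul_assoc Mᴴ, hMM]
    simp [smul_smul, hd']
  have key := markov_key (M1 * M1ᴴ) (M2 * M2ᴴ) (Matrix.posSemidef_self_mul_conjTranspose M1)
    (Matrix.posSemidef_self_mul_conjTranspose M2) (lft e1) (lft e2)
    ((Fintype.card δ : ℂ) • (M * Mᴴ)) hP (by simp [Matrix.conjTranspose_mul])
    (Fintype.card γ) (Fintype.card δ) hc hd H1 H2 ?_ tr1 tr2 hent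
  · have := congrFun (congrFun key (a, b, c)) (a', b', c')
    simp only [Matrix.smul_apply, smul_eq_mul] at this
    rw [Matrix.mul_apply, Fintype.sum_prod_type] at this
    simp only [Fintype.sum_prod_type, lft_apply, e1, e2, Equiv.coe_fn_symm_mk] at this
    simp only [mul_ite, mul_one, mul_zero, ite_mul, zero_mul, Finset.sum_ite_irrel,
      Finset.sum_const_zero, Finset.sum_ite_eq, Finset.sum_ite_eq', Finset.mem_univ, if_true] at this
    rw [this, Matrix.mul_apply]
    simp only [hM, Matrix.of_apply, Matrix.conjTranspose_apply]
    push_cast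
    field_simp
  · intro N
    rw [Matrix.trace_mul_comm, lft_trace]
    have : (Matrix.of fun p q => ∑ r, (lft e2 (M2 * M2ᴴ)) (e1 (p, r)) (e1 (q, r))) =
        (Fintype.card γ : ℂ)⁻¹ • (1 : Matrix (α × γ) (α × γ) ℂ) := by
      ext ⟨a, c⟩ ⟨a', c'⟩
      have := hγ c c'
      rw [Finset.sum_comm] at this
      simp only [lft_apply, e1, e2, Equiv.coe_fn_mk, Equiv.coe_fn_symm_mk, Matrix.of_apply,
        Matrix.smul_apply, Matrix.mul_apply, hM2, Matrix.conjTranspose_apply,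
        Fintype.sum_prod_type, Matrix.one_apply, Prod.mk.injEq]
      by_cases h : a = a'
      · simpa [h] using this
      · simp [h]
    rw [this]
    simp

open scoped Kronecker

theorem vNE_reindex {m n m' n' : Type*} [Fintype m] [DecidableEq m] [Fintype n] [DecidableEq n]
    [Fintype m'] [DecidableEq m'] [Fintype n'] [DecidableEq n'] (e : m' ≃ m) (f : n' ≃ n)
    (M : Matrix m n ℂ) :
    vNE (M.submatrix e f * (M.submatrix e f)ᴴ) = vNE (M * Mᴴ) := by
  rw [Matrix.conjTranspose_submatrix, Matrix.submatrix_mul_equiv]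
  exact vNE_submatrix e _ (Matrix.isHermitian_mul_conjTranspose_self M)

theorem unitary_card {m n : Type*} [Fintype m] [DecidableEq m] [Fintype n] [DecidableEq n]
    {U : Matrix m n ℂ} (hU : IsUnitaryMat U) : Fintype.card m = Fintype.card n := by
  have h := Matrix.trace_mul_comm U Uᴴ
  rw [hU.1, hU.2, Matrix.trace_one, Matrix.trace_one] at h
  exact_mod_cast h

theorem conj_mul {m n : Type*} [Fintype m] [DecidableEq m] [Fintype n] [DecidableEq n]
    {U : Matrix m n ℂ} (hU : IsUnitaryMat U) (x y : Matrix n n ℂ) :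
    (U * x * Uᴴ) * (U * y * Uᴴ) = U * (x * y) * Uᴴ := by
  rw [show (U * x * Uᴴ) * (U * y * Uᴴ) = U * x * (Uᴴ * U) * y * Uᴴ by
    simp only [Matrix.mul_assoc], hU.2]
  simp only [Matrix.mul_assoc, Matrix.mul_one, Matrix.one_mul]

set_option linter.unusedSectionVars false
section bin
variable {A B C D : Type*} [Fintype A] [DecidableEq A] [Fintype B] [DecidableEq B]
    [Fintype C] [DecidableEq C] [Fintype D] [DecidableEq D]

/-- normalized amplitudes -/
def chi (U : Matrix (C × D) (A × B) ℂ) (a : A) (b : B) (c : C) (d : D) : ℂ :=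
  (Real.sqrt (Fintype.card (A × B)) : ℂ)⁻¹ * U (c, d) (a, b)

/-- amplitude matrix for AC versus BD -/
def mAC (U : Matrix (C × D) (A × B) ℂ) : Matrix (A × C) (B × D) ℂ :=
  Matrix.of fun p q => chi U p.1 q.1 p.2 q.2

/-- amplitude matrix for AD versus BC -/
def mAD (U : Matrix (C × D) (A × B) ℂ) : Matrix (A × D) (B × C) ℂ :=
  Matrix.of fun p q => chi U p.1 q.1 q.2 p.2

/-- the binary entropy condition -/
def PCond (U : Matrix (C × D) (A × B) ℂ) : Prop :=
  vNE (mAC U * (mAC U)ᴴ) + vNE (mAD U * (mAD U)ᴴ) =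
    Real.log (Fintype.card (A × B)) / Real.log 2

theorem chi_chi (U : Matrix (C × D) (A × B) ℂ) (a b c d a' b' c' d') :
    chi U a b c d * star (chi U a' b' c' d') = (Fintype.card (A × B) : ℂ)⁻¹ *
      (U (c, d) (a, b) * star (U (c', d') (a', b'))) := by
  simp only [chi, star_mul', star_inv₀, Complex.star_def, Complex.conj_ofReal]
  rw [mul_mul_mul_comm, ← mul_inv, ← Complex.ofReal_mul, Real.mul_self_sqrt (by positivity)]
  push_cast
  rfl

theorem row_orth {U : Matrix (C × D) (A × B) ℂ} (hU : IsUnitaryMat U) (c d c' d') :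
    ∑ a, ∑ b, U (c, d) (a, b) * star (U (c', d') (a, b)) =
      if c = c' ∧ d = d' then 1 else 0 := by
  have := congrFun (congrFun hU.1 (c, d)) (c', d')
  simpa [Matrix.mul_apply, Fintype.sum_prod_type, Matrix.one_apply] using this

theorem col_orth {U : Matrix (C × D) (A × B) ℂ} (hU : IsUnitaryMat U) (a b a' b') :
    ∑ c, ∑ d, U (c, d) (a, b) * star (U (c, d) (a', b')) =
      if a = a' ∧ b = b' then 1 else 0 := by
  have := congrFun (congrFun hU.2 (a', b')) (a, b)
  simp only [Matrix.mul_apply, Fintype.sum_prod_type, Matrix.one_apply,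
    Matrix.conjTranspose_apply, Prod.mk.injEq] at this
  simp only [mul_comm _ (star _), this, eq_comm]

theorem flatD [Nonempty C] {U : Matrix (C × D) (A × B) ℂ} (hU : IsUnitaryMat U) (d d') :
    ∑ a, ∑ b, ∑ c, chi U a b c d * star (chi U a b c d') =
      if d = d' then (Fintype.card D : ℂ)⁻¹ else 0 := by
  have hN : (Fintype.card (A × B) : ℂ) = Fintype.card C * Fintype.card D := by
    rw [← unitary_card hU, Fintype.card_prod]; push_cast; rfl
  have hC : (Fintype.card C : ℂ) ≠ 0 := by exact_mod_cast Fintype.card_ne_zero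
  simp only [chi_chi, ← Finset.mul_sum]
  have : ∑ a, ∑ b, ∑ c, U (c, d) (a, b) * star (U (c, d') (a, b)) =
      ∑ c, ∑ a, ∑ b, U (c, d) (a, b) * star (U (c, d') (a, b)) := by
    rw [Finset.sum_comm (s := (Finset.univ : Finset C))]
    refine Finset.sum_congr rfl fun a _ => ?_
    rw [Finset.sum_comm]
  rw [this]
  simp only [row_orth hU, true_and, Finset.sum_const, Finset.card_univ, hN]
  by_cases h : d = d'
  · simp [h, mul_comm, hC]
  · simp [h]

theorem flatC [Nonempty D] {U : Matrix (C × D) (A × B) ℂ} (hU : IsUnitaryMat U) (c c') :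
    ∑ a, ∑ b, ∑ d, chi U a b c d * star (chi U a b c' d) =
      if c = c' then (Fintype.card C : ℂ)⁻¹ else 0 := by
  have hN : (Fintype.card (A × B) : ℂ) = Fintype.card C * Fintype.card D := by
    rw [← unitary_card hU, Fintype.card_prod]; push_cast; rfl
  have hC : (Fintype.card D : ℂ) ≠ 0 := by exact_mod_cast Fintype.card_ne_zero
  simp only [chi_chi, ← Finset.mul_sum]
  have : ∑ a, ∑ b, ∑ d, U (c, d) (a, b) * star (U (c', d) (a, b)) =
      ∑ d, ∑ a, ∑ b, U (c, d) (a, b) * star (U (c', d) (a, b)) := by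
    rw [Finset.sum_comm (s := (Finset.univ : Finset D))]
    refine Finset.sum_congr rfl fun a _ => ?_
    rw [Finset.sum_comm]
  rw [this]
  simp only [row_orth hU, and_true, Finset.sum_const, Finset.card_univ, hN]
  by_cases h : c = c'
  · simp [h, mul_comm, hC]
  · simp [h]

theorem flatB [Nonempty A] {U : Matrix (C × D) (A × B) ℂ} (hU : IsUnitaryMat U) (b b') :
    ∑ c, ∑ d, ∑ a, chi U a b c d * star (chi U a b' c d) =
      if b = b' then (Fintype.card B : ℂ)⁻¹ else 0 := by
  have hN : (Fintype.card (A × B) : ℂ) = Fintype.card A * Fintype.card B := by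
    rw [Fintype.card_prod]; push_cast; rfl
  have hC : (Fintype.card A : ℂ) ≠ 0 := by exact_mod_cast Fintype.card_ne_zero
  simp only [chi_chi, ← Finset.mul_sum]
  have : ∑ c, ∑ d, ∑ a, U (c, d) (a, b) * star (U (c, d) (a, b')) =
      ∑ a, ∑ c, ∑ d, U (c, d) (a, b) * star (U (c, d) (a, b')) := by
    rw [Finset.sum_comm (s := (Finset.univ : Finset A))]
    refine Finset.sum_congr rfl fun a _ => ?_
    rw [Finset.sum_comm]
  rw [this]
  simp only [col_orth hU, true_and, Finset.sum_const, Finset.card_univ, hN]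
  by_cases h : b = b'
  · simp [h, mul_comm, hC]
  · simp [h]

theorem flatA [Nonempty B] {U : Matrix (C × D) (A × B) ℂ} (hU : IsUnitaryMat U) (a a') :
    ∑ c, ∑ d, ∑ b, chi U a b c d * star (chi U a' b c d) =
      if a = a' then (Fintype.card A : ℂ)⁻¹ else 0 := by
  have hN : (Fintype.card (A × B) : ℂ) = Fintype.card A * Fintype.card B := by
    rw [Fintype.card_prod]; push_cast; rfl
  have hC : (Fintype.card B : ℂ) ≠ 0 := by exact_mod_cast Fintype.card_ne_zero
  simp only [chi_chi, ← Finset.mul_sum]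
  have : ∑ c, ∑ d, ∑ b, U (c, d) (a, b) * star (U (c, d) (a', b)) =
      ∑ b, ∑ c, ∑ d, U (c, d) (a, b) * star (U (c, d) (a', b)) := by
    rw [Finset.sum_comm (s := (Finset.univ : Finset B))]
    refine Finset.sum_congr rfl fun a _ => ?_
    rw [Finset.sum_comm]
  rw [this]
  simp only [col_orth hU, and_true, Finset.sum_const, Finset.card_univ, hN]
  by_cases h : a = a'
  · simp [h, mul_comm, hC]
  · simp [h]

theorem comm_right [Nonempty D] (M : Matrix (C × D) (C × D) ℂ)
    (h : ∀ d d', Commute M ((1 : Matrix C C ℂ) ⊗ₖ Matrix.single d d' 1)) :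
    ∃ n : Matrix C C ℂ, M = n ⊗ₖ (1 : Matrix D D ℂ) := by
  obtain ⟨d0⟩ := ‹Nonempty D›
  refine ⟨Matrix.of fun c c' => M (c, d0) (c', d0), ?_⟩
  ext ⟨c, x⟩ ⟨c', y⟩
  have := congrFun (congrFun (h y d0).eq (c, x)) (c', d0)
  simp only [Matrix.mul_apply, Matrix.kroneckerMap_apply, Fintype.sum_prod_type, Matrix.one_apply,
    Matrix.single_apply] at this
  simp only [Matrix.kroneckerMap_apply, Matrix.of_apply, Matrix.one_apply]
  simpa [ite_and, Finset.sum_ite_irrel, eq_comm] using this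

theorem star_bin [Nonempty A] [Nonempty B] [Nonempty C] [Nonempty D]
    {U : Matrix (C × D) (A × B) ℂ} (hU : IsUnitaryMat U) (hP : PCond U) (c c' : C) :
    ∃ (n : C → Matrix C C ℂ) (β : C → Matrix B B ℂ),
      (∀ c1 (b : Matrix B B ℂ), Commute (n c1 ⊗ₖ (1 : Matrix D D ℂ)) (U * ((1 : Matrix A A ℂ) ⊗ₖ b) * Uᴴ)) ∧
      Matrix.single c c' (1 : ℂ) ⊗ₖ (1 : Matrix D D ℂ) =
        ∑ c1, (n c1 ⊗ₖ (1 : Matrix D D ℂ)) * (U * ((1 : Matrix A A ℂ) ⊗ₖ β c1) * Uᴴ) := by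
  have hCD : (Fintype.card C : ℝ) * Fintype.card D = Fintype.card (A × B) := by
    rw [← unitary_card hU, Fintype.card_prod]; push_cast; rfl
  have T1 := tens (chi U) (flatD hU) (flatC hU) (mAC U) (mAD U)ᵀ rfl rfl (by
    rw [← vNE_compl, hCD]; exact hP)
  have T2 := tens (fun a b d c => chi U a b c d) (flatC hU) (flatD hU) (mAD U) (mAC U)ᵀ rfl rfl (by
    rw [← vNE_compl, mul_comm, hCD, add_comm]; exact hP)
  have T3 := tens (fun c d a b => chi U a b c d) (flatB hU) (flatA hU)
    ((mAC U).submatrix (Equiv.prodComm _ _) (Equiv.prodComm _ _))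
    ((mAD U).submatrix (Equiv.prodComm _ _) (Equiv.prodComm _ _)) rfl rfl (by
    rw [vNE_reindex, vNE_reindex]
    have : (Fintype.card A : ℝ) * Fintype.card B = Fintype.card (A × B) := by
      rw [Fintype.card_prod]; push_cast; rfl
    rw [this]; exact hP)
  simp only [Matrix.conjTranspose_submatrix, Matrix.submatrix_mul_equiv, Matrix.submatrix_apply,
    Equiv.prodComm_apply, Prod.swap_prod_mk] at T3
  set R := mAC U * (mAC U)ᴴ with hR
  set S := mAD U * (mAD U)ᴴ with hS
  have RH : ∀ p q, star (R p q) = R q p := fun p q => by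
    have : Rᴴ = R := by simp [hR, Matrix.conjTranspose_mul]
    conv_rhs => rw [← this]
    rfl
  have SH : ∀ p q, star (S p q) = S q p := fun p q => by
    have : Sᴴ = S := by simp [hS, Matrix.conjTranspose_mul]
    conv_rhs => rw [← this]
    rfl
  set R2 := (mAD U)ᵀ * ((mAD U)ᵀ)ᴴ with hR2
  set S2 := (mAC U)ᵀ * ((mAC U)ᵀ)ᴴ with hS2
  let XC : C → C → Matrix A A ℂ := fun c1 c => Matrix.of fun a a' => R (a', c1) (a, c)
  let XD : D → D → Matrix A A ℂ := fun d1 d => Matrix.of fun a a' => S (a', d1) (a, d)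
  let YC : C → C → Matrix B B ℂ := fun c' c1 => Matrix.of fun b b' => R2 (b', c') (b, c1)
  let YD : D → D → Matrix B B ℂ := fun d' d1 => Matrix.of fun b b' => S2 (b', d') (b, d1)
  have hN0 : (Fintype.card (A × B) : ℂ) ≠ 0 := by exact_mod_cast Fintype.card_ne_zero
  have hC0 : (Fintype.card C : ℂ) ≠ 0 := by exact_mod_cast Fintype.card_ne_zero
  have hD0 : (Fintype.card D : ℂ) ≠ 0 := by exact_mod_cast Fintype.card_ne_zero
  have comm : ∀ c1 c2 d1 d2, Commute (XC c1 c2) (XD d1 d2) := by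
    intro c1 c2 d1 d2
    ext a a'
    rw [Matrix.mul_apply, Matrix.mul_apply]
    have h1 := T3 c1 c2 d1 d2 a' a
    have h2 := congrArg star (T3 c2 c1 d2 d1 a a')
    simp only [star_sum, star_mul', RH, SH, star_star, star_inv₀, star_natCast] at h2
    simp only [XC, XD, Matrix.of_apply]
    simp only [mul_comm (star _)] at h2
    rw [show ∑ x, S (x, d1) (a, d2) * R (a', c1) (x, c2) = _ from h2, ← h1]
    exact Finset.sum_congr rfl fun _ _ => mul_comm _ _
  have G1 : ∀ c c', Uᴴ * (Matrix.single c c' (1:ℂ) ⊗ₖ (1 : Matrix D D ℂ)) * U =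
      ((Fintype.card (A × B) : ℂ) * Fintype.card C) • ∑ c1, XC c1 c ⊗ₖ YC c' c1 := by
    intro c c'
    ext ⟨a, b⟩ ⟨a', b'⟩
    have h := T1 a' a b' b c' c
    have h' : ∑ c1, (XC c1 c ⊗ₖ YC c' c1) (a, b) (a', b') =
        (Fintype.card C : ℂ)⁻¹ * ∑ d, chi U a' b' c' d * star (chi U a b c d) := by
      rw [← h]
      exact Finset.sum_congr rfl fun _ _ => mul_comm _ _
    rw [Matrix.smul_apply, Matrix.sum_apply, h']
    simp only [chi_chi, ← Finset.mul_sum, Matrix.mul_apply, Matrix.kroneckerMap_apply,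
      Fintype.sum_prod_type, Matrix.single_apply, Matrix.one_apply, Matrix.conjTranspose_apply]
    simp [ite_and, Finset.sum_ite_irrel]
    field_simp
    exact Finset.sum_congr rfl fun _ _ => mul_comm _ _
  have G2 : ∀ d d', Uᴴ * ((1 : Matrix C C ℂ) ⊗ₖ Matrix.single d d' (1:ℂ)) * U =
      ((Fintype.card (A × B) : ℂ) * Fintype.card D) • ∑ d1, XD d1 d ⊗ₖ YD d' d1 := by
    intro d d'
    ext ⟨a, b⟩ ⟨a', b'⟩
    have h := T2 a' a b' b d' d
    have h' : ∑ d1, (XD d1 d ⊗ₖ YD d' d1) (a, b) (a', b') =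
        (Fintype.card D : ℂ)⁻¹ * ∑ c, chi U a' b' c d' * star (chi U a b c d) := by
      rw [← h]
      exact Finset.sum_congr rfl fun _ _ => mul_comm _ _
    rw [Matrix.smul_apply, Matrix.sum_apply, h']
    simp only [chi_chi, ← Finset.mul_sum, Matrix.mul_apply, Matrix.kroneckerMap_apply,
      Fintype.sum_prod_type, Matrix.single_apply, Matrix.one_apply, Matrix.conjTranspose_apply]
    simp [ite_and, Finset.sum_ite_irrel]
    field_simp
    exact Finset.sum_congr rfl fun _ _ => mul_comm _ _
  have comm2 : ∀ c1 c2 d d', Commute (U * (XC c1 c2 ⊗ₖ (1 : Matrix B B ℂ)) * Uᴴ)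
      ((1 : Matrix C C ℂ) ⊗ₖ Matrix.single d d' (1:ℂ)) := by
    intro c1 c2 d d'
    have h1 : Commute (XC c1 c2 ⊗ₖ (1 : Matrix B B ℂ))
        (Uᴴ * ((1 : Matrix C C ℂ) ⊗ₖ Matrix.single d d' (1:ℂ)) * U) := by
      rw [G2]
      refine Commute.smul_right (Commute.sum_right _ _ _ fun d1 _ => ?_) _
      rw [commute_iff_eq, ← Matrix.mul_kronecker_mul, ← Matrix.mul_kronecker_mul, (comm c1 c2 d1 d).eq]
      simp
    have h2 : (1 : Matrix C C ℂ) ⊗ₖ Matrix.single d d' (1:ℂ) =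
        U * (Uᴴ * ((1 : Matrix C C ℂ) ⊗ₖ Matrix.single d d' (1:ℂ)) * U) * Uᴴ := by
      simp only [← Matrix.mul_assoc, hU.1, Matrix.one_mul]
      rw [Matrix.mul_assoc, hU.1, Matrix.mul_one]
    rw [h2]
    have conj := conj_mul hU
    rw [commute_iff_eq, conj, conj, h1.eq]
  have nex := fun c1 c2 => comm_right _ (comm2 c1 c2)
  choose n hn using nex
  have conj := conj_mul hU
  refine ⟨fun c1 => n c1 c, fun c1 => ((Fintype.card (A × B) : ℂ) * Fintype.card C) • YC c' c1,
    ?_, ?_⟩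
  · intro c1 b
    rw [← hn, commute_iff_eq, conj, conj, ← Matrix.mul_kronecker_mul, ← Matrix.mul_kronecker_mul]
    simp
  · simp only [← hn, conj]
    rw [← Matrix.sum_mul, ← Matrix.mul_sum]
    have : ∑ c1, XC c1 c ⊗ₖ (1 : Matrix B B ℂ) *
        ((1 : Matrix A A ℂ) ⊗ₖ (((Fintype.card (A × B) : ℂ) * Fintype.card C) • YC c' c1)) =
        Uᴴ * (Matrix.single c c' (1:ℂ) ⊗ₖ (1 : Matrix D D ℂ)) * U := by
      rw [G1, Finset.smul_sum]
      refine Finset.sum_congr rfl fun c1 _ => ?_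
      rw [← Matrix.mul_kronecker_mul]
      simp [Matrix.kronecker_smul]
    rw [this]
    simp only [← Matrix.mul_assoc, hU.1, Matrix.one_mul]
    rw [Matrix.mul_assoc, hU.1, Matrix.mul_one]
end bin

open scoped Kronecker

theorem rank_lt {γ : Type*} [Fintype γ] [DecidableEq γ] {h y : Matrix γ γ ℂ}
    (hk : ∀ u, h *ᵥ u = 0 → y *ᵥ u = 0) (v : γ → ℂ) (hv : h *ᵥ v ≠ 0) (yv : y *ᵥ v = 0) :
    y.rank < h.rank := by
  have h1 := LinearMap.finrank_range_add_finrank_ker h.mulVecLin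
  have h2 := LinearMap.finrank_range_add_finrank_ker y.mulVecLin
  have : LinearMap.ker h.mulVecLin < LinearMap.ker y.mulVecLin := by
    refine lt_of_le_of_ne (fun u hu => ?_) (fun e => hv ?_)
    · simpa using hk u (by simpa using hu)
    · have : v ∈ LinearMap.ker y.mulVecLin := by simpa using yv
      rw [← e] at this
      simpa using this
  have := Submodule.finrank_lt_finrank_of_lt this
  unfold Matrix.rank
  omega

theorem proj_iso {γ : Type*} [Fintype γ] [DecidableEq γ] {p : Matrix γ γ ℂ} (hp : pᴴ = p)
    (hpp : p * p = p) : ∃ (r : ℕ) (B : Matrix γ (Fin r) ℂ), Bᴴ * B = 1 ∧ B * Bᴴ = p := by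
  obtain ⟨Q, l, hQ1, hQ2, hl, -⟩ := spectral (ρ := p) hp
  have hD : Qᴴ * p * Q = diagonal (fun i => (l i : ℂ)) := by
    rw [hl, show Qᴴ * (Q * diagonal (fun i => (l i : ℂ)) * Qᴴ) * Q =
      (Qᴴ * Q) * diagonal (fun i => (l i : ℂ)) * (Qᴴ * Q) by simp only [Matrix.mul_assoc], hQ2]
    simp
  have hDD : diagonal (fun i => (l i : ℂ)) * diagonal (fun i => (l i : ℂ)) =
      diagonal (fun i => (l i : ℂ)) := by
    rw [← hD, show Qᴴ * p * Q * (Qᴴ * p * Q) = Qᴴ * (p * (Q * Qᴴ) * p) * Q by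
      simp only [Matrix.mul_assoc], hQ1, Matrix.mul_one, hpp]
  have hl01 : ∀ i, l i = if l i = 1 then 1 else 0 := by
    intro i
    rw [Matrix.diagonal_mul_diagonal] at hDD
    have h1 := congrFun (Matrix.diagonal_injective hDD) i
    have h2 : l i * l i = l i := by exact_mod_cast h1
    split_ifs with h
    · exact h
    · have : l i * (l i - 1) = 0 := by linarith
      rcases mul_eq_zero.mp this with h' | h'
      · exact h'
      · exact absurd (by linarith) h
  let f := Fintype.equivFin {i // l i = 1}
  refine ⟨_, Matrix.of fun g t => Q g (f.symm t).1, ?_, ?_⟩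
  · ext t t'
    have := congrFun (congrFun hQ2 (f.symm t).1) (f.symm t').1
    simp only [Matrix.mul_apply, Matrix.conjTranspose_apply, Matrix.of_apply] at this ⊢
    rw [this]
    simp [Matrix.one_apply, Subtype.coe_inj]
  · ext g g'
    rw [hl]
    simp only [Matrix.mul_apply, Matrix.conjTranspose_apply, Matrix.of_apply]
    rw [f.symm.sum_comp (fun t => Q g t.1 * star (Q g' t.1))]
    rw [← Finset.sum_subtype (Finset.univ.filter (fun i => l i = 1)) (by simp)
      (fun t => Q g t * star (Q g' t)), Finset.sum_filter]
    refine Finset.sum_congr rfl fun i _ => ?_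
    rw [← Matrix.mul_apply, Matrix.mul_diagonal]
    rcases eq_or_ne (l i) 1 with h | h
    · simp [h]
    · have := hl01 i
      rw [if_neg h] at this
      simp [this]

theorem factor {γ : Type*} [Fintype γ] [DecidableEq γ] [Nonempty γ]
    (N : Subalgebra ℂ (Matrix γ γ ℂ)) (hstar : ∀ x ∈ N, xᴴ ∈ N)
    (hprime : ∀ x ∈ N, ∀ y ∈ N, (∀ z ∈ N, x * z * y = 0) → x = 0 ∨ y = 0) :
    ∃ (e e' : ℕ) (W : Matrix (Fin e × Fin e') γ ℂ), IsUnitaryMat W ∧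
      ∀ x, x ∈ N ↔ ∃ m : Matrix (Fin e) (Fin e) ℂ, x = Wᴴ * (m ⊗ₖ (1 : Matrix (Fin e') (Fin e') ℂ)) * W := by
  -- minimal rank element
  obtain ⟨x, ⟨hxN, hx0⟩, hxmin⟩ : ∃ x, (x ∈ N ∧ x ≠ 0) ∧ ∀ y, y ∈ N → y ≠ 0 → x.rank ≤ y.rank := by
    have hne : ∃ r, ∃ x, x ∈ N ∧ x ≠ 0 ∧ x.rank = r := ⟨_, 1, one_mem N, one_ne_zero, rfl⟩
    obtain ⟨x, h1, h2, h3⟩ := Nat.find_spec hne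
    refine ⟨x, ⟨h1, h2⟩, fun y hy hy0 => ?_⟩
    rw [h3]
    exact Nat.find_min' hne ⟨y, hy, hy0, rfl⟩
  obtain ⟨p, hpN, hp0, hpH, hpp, hprk⟩ : ∃ p ∈ N, p ≠ 0 ∧ pᴴ = p ∧ p * p = p ∧
      ∀ y, y ∈ N → y ≠ 0 → p.rank ≤ y.rank := by
    set h := xᴴ * x with hh
    have hN : h ∈ N := mul_mem (hstar x hxN) hxN
    have hH : h.IsHermitian := Matrix.isHermitian_conjTranspose_mul_self x
    have h0 : h ≠ 0 := fun e => hx0 (Matrix.conjTranspose_mul_self_eq_zero.mp e)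
    have hrk : h.rank = x.rank := Matrix.rank_conjTranspose_mul_self x
    obtain ⟨v, l, hl, hv, hvl⟩ := hH.exists_eigenvector_of_ne_zero h0
    have hy : h * h - (l : ℂ) • h = 0 := by
      by_contra hy
      have hlt := rank_lt (h := h) (y := h * h - (l : ℂ) • h) (fun u hu => by
        rw [Matrix.sub_mulVec, ← Matrix.mulVec_mulVec, hu, Matrix.smul_mulVec, hu]; simp) v ?_ ?_
      · have := hxmin _ (sub_mem (mul_mem hN hN) (N.smul_mem hN (l : ℂ))) hy
        omega
      · rw [hvl]
        exact smul_ne_zero hl hv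
      · have hvl' : h *ᵥ v = (l : ℂ) • v := by rw [hvl]; rfl
        rw [Matrix.sub_mulVec, ← Matrix.mulVec_mulVec, hvl', Matrix.smul_mulVec, hvl',
          Matrix.mulVec_smul, hvl', sub_self]
    have hl' : (l : ℂ) ≠ 0 := by exact_mod_cast hl
    refine ⟨(l : ℂ)⁻¹ • h, N.smul_mem hN _, smul_ne_zero (inv_ne_zero hl') h0, ?_, ?_, ?_⟩
    · rw [Matrix.conjTranspose_smul, hH.eq]; simp
    · rw [Matrix.smul_mul, Matrix.mul_smul, sub_eq_zero.mp hy, smul_smul, smul_smul]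
      congr 1
      field_simp
    · intro y hyN hy0
      refine le_trans ?_ (hrk ▸ hxmin y hyN hy0)
      have : (l : ℂ)⁻¹ • h = h * ((l : ℂ)⁻¹ • 1) := by simp
      rw [this]
      exact Matrix.rank_mul_le_left _ _
  obtain ⟨r, B, hB1, hB2⟩ := proj_iso hpH hpp
  have hr : Nonempty (Fin r) := by
    by_contra hr
    rw [not_nonempty_iff] at hr
    apply hp0
    rw [← hB2]
    ext; simp [Matrix.mul_apply]
  have pB : p * B = B := by rw [← hB2, Matrix.mul_assoc, hB1, Matrix.mul_one]
  have Bp : Bᴴ * p = Bᴴ := by rw [← hB2, ← Matrix.mul_assoc, hB1, Matrix.one_mul]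
  have corner : ∀ z ∈ N, ∃ μ : ℂ, p * z * p = μ • p := by
    intro z hz
    obtain ⟨μ, hμ⟩ := Module.End.exists_eigenvalue (Matrix.toLin' (Bᴴ * z * B))
    obtain ⟨v, hv⟩ := hμ.exists_hasEigenvector
    have hv1 : (Bᴴ * z * B) *ᵥ v = μ • v := by
      have := hv.apply_eq_smul
      rwa [Matrix.toLin'_apply] at this
    refine ⟨μ, ?_⟩
    rw [← sub_eq_zero]
    by_contra hy
    have pv : p *ᵥ (B *ᵥ v) = B *ᵥ v := by rw [Matrix.mulVec_mulVec, pB]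
    have hlt := rank_lt (h := p) (y := p * z * p - μ • p) (fun u hu => by
        rw [Matrix.sub_mulVec, ← Matrix.mulVec_mulVec, hu, Matrix.smul_mulVec, hu]; simp)
        (B *ᵥ v) ?_ ?_
    · have := hprk _ (sub_mem (mul_mem (mul_mem hpN hz) hpN) (N.smul_mem hpN μ)) hy
      omega
    · rw [pv]
      intro h
      apply hv.2
      have := congrArg (Bᴴ *ᵥ ·) h
      simpa [Matrix.mulVec_mulVec, hB1] using this
    · rw [Matrix.sub_mulVec, Matrix.smul_mulVec, ← Matrix.mulVec_mulVec, pv]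
      have : (p * z) *ᵥ (B *ᵥ v) = B *ᵥ ((Bᴴ * z * B) *ᵥ v) := by
        rw [Matrix.mulVec_mulVec, Matrix.mulVec_mulVec, ← hB2]
        simp only [Matrix.mul_assoc]
      rw [this, hv1, Matrix.mulVec_smul, sub_self]
  obtain ⟨t0⟩ := id hr
  set ξ : γ → ℂ := fun g => B g t0 with hξ
  have hξp : p *ᵥ ξ = ξ := by
    ext g
    exact congrFun (congrFun pB g) t0
  have hξ1 : star ξ ⬝ᵥ ξ = 1 := by
    have := congrFun (congrFun hB1 t0) t0
    simpa [Matrix.mul_apply, dotProduct] using this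
  -- inner products
  have inner_p : ∀ a ∈ N, ∀ b ∈ N, (a * p)ᴴ * (b * p) =
      (star (a *ᵥ ξ) ⬝ᵥ (b *ᵥ ξ)) • p := by
    intro a ha b hb
    obtain ⟨μ, hμ⟩ := corner (aᴴ * b) (mul_mem (hstar a ha) hb)
    have e1 : (a * p)ᴴ * (b * p) = μ • p := by
      rw [← hμ, Matrix.conjTranspose_mul, hpH]; simp only [Matrix.mul_assoc]
    rw [e1]
    congr 1
    have e2 : star ξ ⬝ᵥ ((μ • p) *ᵥ ξ) = μ := by
      rw [Matrix.smul_mulVec, hξp, dotProduct_smul, hξ1]; simp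
    rw [← e2, ← e1, ← Matrix.mulVec_mulVec, Matrix.dotProduct_mulVec, Matrix.vecMul_conjTranspose,
      star_star, ← Matrix.mulVec_mulVec, ← Matrix.mulVec_mulVec, hξp]
  let L : Submodule ℂ (EuclideanSpace ℂ γ) :=
    { carrier := {w | ∃ a ∈ N, w = WithLp.toLp 2 (a *ᵥ ξ)}
      zero_mem' := ⟨0, zero_mem N, by simp⟩
      add_mem' := by
        rintro _ _ ⟨a, ha, rfl⟩ ⟨b, hb, rfl⟩
        exact ⟨a + b, add_mem ha hb, by rw [Matrix.add_mulVec]; rfl⟩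
      smul_mem' := by
        rintro c _ ⟨a, ha, rfl⟩
        exact ⟨c • a, N.smul_mem ha c, by rw [Matrix.smul_mulVec]; rfl⟩ }
  obtain ⟨e, ⟨bs⟩⟩ : ∃ e, Nonempty (OrthonormalBasis (Fin e) ℂ L) :=
    ⟨_, ⟨stdOrthonormalBasis ℂ L⟩⟩
  have hv : ∀ i, ∃ a ∈ N, ((bs i : L) : EuclideanSpace ℂ γ) = WithLp.toLp 2 (a *ᵥ ξ) := fun i => (bs i).2
  choose a ha hba using hv
  have orth : ∀ i j, (a i * p)ᴴ * (a j * p) = if i = j then p else 0 := by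
    intro i j
    rw [inner_p _ (ha i) _ (ha j)]
    have := orthonormal_iff_ite.mp bs.orthonormal i j
    rw [Submodule.coe_inner, hba, hba, EuclideanSpace.inner_toLp_toLp] at this
    rw [dotProduct_comm, this]
    simp
  obtain ⟨v, hvdef⟩ : ∃ v : Fin e → Matrix γ γ ℂ, v = fun i => a i * p := ⟨_, rfl⟩
  have hvN : ∀ i, v i ∈ N := fun i => hvdef ▸ mul_mem (ha i) hpN
  have vp : ∀ i, v i * p = v i := fun i => by rw [hvdef, Matrix.mul_assoc, hpp]
  have spanv : ∀ z ∈ N, ∃ c : Fin e → ℂ, z * p = ∑ i, c i • v i := by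
    intro z hz
    let w : L := ⟨WithLp.toLp 2 (z *ᵥ ξ), z, hz, rfl⟩
    refine ⟨fun i => bs.repr w i, ?_⟩
    have hw := congrArg (fun u : L => (WithLp.ofLp (u : EuclideanSpace ℂ γ))) (bs.sum_repr w)
    have hw' : ∑ i, bs.repr w i • (a i *ᵥ ξ) = z *ᵥ ξ := by
      simp only [w, Submodule.coe_sum, Submodule.coe_smul, hba, WithLp.ofLp_sum,
        WithLp.ofLp_smul] at hw
      exact hw
    set y := z - ∑ i, bs.repr w i • a i with hy
    have hyN : y ∈ N := sub_mem hz (sum_mem fun i _ => N.smul_mem (ha i) _)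
    have h1 := inner_p y hyN y hyN
    have h2 : y *ᵥ ξ = 0 := by
      rw [hy, Matrix.sub_mulVec, Matrix.sum_mulVec]
      simp only [Matrix.smul_mulVec]
      rw [hw', sub_self]
    rw [h2, dotProduct_zero, zero_smul] at h1
    have h3 := Matrix.conjTranspose_mul_self_eq_zero.mp h1
    rw [hy, Matrix.sub_mul, Matrix.sum_mul, sub_eq_zero] at h3
    rw [h3]
    simp [hvdef]
  have orth' : ∀ i j, (v i)ᴴ * v j = if i = j then p else 0 := by
    rw [hvdef]; exact orth
  have hQ : ∑ i, v i * (v i)ᴴ = 1 := by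
    have hQN : ∑ i, v i * (v i)ᴴ ∈ N := sum_mem fun i _ => mul_mem (hvN i) (hstar _ (hvN i))
    have hz0 : ∀ z ∈ N, (1 - ∑ i, v i * (v i)ᴴ) * z * p = 0 := by
      intro z hz
      obtain ⟨c, hc⟩ := spanv z hz
      rw [Matrix.mul_assoc, hc, Matrix.sub_mul, Matrix.one_mul, sub_eq_zero, Matrix.mul_sum]
      refine Finset.sum_congr rfl fun j _ => ?_
      rw [Matrix.mul_smul, Matrix.sum_mul]
      congr 1
      simp only [Matrix.mul_assoc, orth']
      simp [vp]
    rcases hprime (1 - ∑ i, v i * (v i)ᴴ) (sub_mem (one_mem N) hQN) p hpN hz0 with h | h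
    · exact (sub_eq_zero.mp h).symm
    · exact absurd h hp0
  obtain ⟨T, hT⟩ : ∃ T : Fin e → Matrix γ (Fin r) ℂ, ∀ i, T i = v i * B := ⟨_, fun _ => rfl⟩
  let Wt : Matrix γ (Fin e × Fin r) ℂ := Matrix.of fun g q => T q.1 g q.2
  have hW1 : Wtᴴ * Wt = 1 := by
    ext ⟨i, t⟩ ⟨j, t'⟩
    have h1 : (Wtᴴ * Wt) (i, t) (j, t') = ((T i)ᴴ * T j) t t' := by
      simp [Wt, Matrix.mul_apply]
    have h2 : (T i)ᴴ * T j = if i = j then 1 else 0 := by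
      rw [hT, hT, Matrix.conjTranspose_mul, show Bᴴ * (v i)ᴴ * (v j * B) = Bᴴ * ((v i)ᴴ * v j) * B by
        simp only [Matrix.mul_assoc], orth']
      split_ifs
      · rw [Bp, hB1]
      · simp
    rw [h1, h2]
    by_cases hij : i = j <;> simp [hij, Matrix.one_apply]
  have K : ∀ m : Matrix (Fin e) (Fin e) ℂ, Wt * (m ⊗ₖ (1 : Matrix (Fin r) (Fin r) ℂ)) * Wtᴴ =
      ∑ i, ∑ j, m i j • (v i * (v j)ᴴ) := by
    intro m
    ext g g'
    have hvv : ∀ i j, v i * (v j)ᴴ = T i * (T j)ᴴ := by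
      intro i j
      rw [hT, hT, Matrix.conjTranspose_mul, show v i * B * (Bᴴ * (v j)ᴴ) = v i * (B * Bᴴ) * (v j)ᴴ by
        simp only [Matrix.mul_assoc], hB2, vp]
    simp only [hvv, Matrix.sum_apply, Matrix.smul_apply, Matrix.mul_apply,
      Matrix.conjTranspose_apply, Fintype.sum_prod_type, Matrix.kroneckerMap_apply, Wt,
      Matrix.of_apply, Matrix.one_apply, mul_ite, mul_one, mul_zero,
      Finset.sum_ite_eq', Finset.sum_ite_eq, Finset.mem_univ, if_true, smul_eq_mul]
    simp only [Finset.sum_mul, Finset.mul_sum]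
    refine (Finset.sum_congr rfl fun j _ => Finset.sum_comm).trans ?_
    rw [Finset.sum_comm]
    refine Finset.sum_congr rfl fun i _ => Finset.sum_congr rfl fun j _ =>
      Finset.sum_congr rfl fun t _ => ?_
    ring
  refine ⟨e, r, Wtᴴ, ⟨by rw [Matrix.conjTranspose_conjTranspose, hW1], ?_⟩, ?_⟩
  · have := K 1
    rw [Matrix.one_kronecker_one, Matrix.mul_one] at this
    rw [Matrix.conjTranspose_conjTranspose, this, ← hQ]
    refine Finset.sum_congr rfl fun i _ => ?_
    simp [Matrix.one_apply]
  · intro x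
    rw [Matrix.conjTranspose_conjTranspose]
    constructor
    · intro hx
      have hμ : ∀ i j, ∃ μ : ℂ, (v i)ᴴ * x * v j = μ • p := by
        intro i j
        obtain ⟨μ, hμ⟩ := corner ((v i)ᴴ * x * v j) (mul_mem (mul_mem (hstar _ (hvN i)) hx) (hvN j))
        refine ⟨μ, ?_⟩
        rw [← hμ]
        have h1 : p * (v i)ᴴ = (v i)ᴴ := by
          conv_rhs => rw [← vp i, Matrix.conjTranspose_mul, hpH]
        rw [← Matrix.mul_assoc, ← Matrix.mul_assoc, h1, Matrix.mul_assoc _ (v j) p, vp]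
      choose m hm using hμ
      refine ⟨Matrix.of m, ?_⟩
      rw [K]
      calc x = (∑ i, v i * (v i)ᴴ) * x * (∑ j, v j * (v j)ᴴ) := by rw [hQ]; simp
        _ = ∑ i, ∑ j, v i * ((v i)ᴴ * x * v j) * (v j)ᴴ := by
          simp only [Matrix.sum_mul, Matrix.mul_sum, Matrix.mul_assoc]
          rw [Finset.sum_comm]
        _ = _ := by
          refine Finset.sum_congr rfl fun i _ => Finset.sum_congr rfl fun j _ => ?_
          rw [hm, Matrix.mul_smul, Matrix.smul_mul, vp]; rfl
    · rintro ⟨m, rfl⟩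
      rw [K]
      exact sum_mem fun i _ => sum_mem fun j _ => N.smul_mem (mul_mem (hvN i) (hstar _ (hvN j))) _

open scoped Kronecker
set_option linter.unusedSectionVars false

section tensor
variable {J : Type*} [Fintype J] [DecidableEq J] {α β γ : J → Type*}
  [∀ j, Fintype (α j)] [∀ j, DecidableEq (α j)] [∀ j, Fintype (β j)] [∀ j, DecidableEq (β j)]
  [∀ j, Fintype (γ j)] [∀ j, DecidableEq (γ j)]

/-- tensor product of a family of matrices -/
def tp (M : ∀ j, Matrix (α j) (β j) ℂ) : Matrix (∀ j, α j) (∀ j, β j) ℂ :=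
  Matrix.of fun x y => ∏ j, M j (x j) (y j)

theorem tp_apply (M : ∀ j, Matrix (α j) (β j) ℂ) (x y) : tp M x y = ∏ j, M j (x j) (y j) := rfl

theorem tp_mul (M : ∀ j, Matrix (α j) (β j) ℂ) (N : ∀ j, Matrix (β j) (γ j) ℂ) :
    tp M * tp N = tp (fun j => M j * N j) := by
  ext x y
  simp only [Matrix.mul_apply, tp_apply, ← Finset.prod_mul_distrib]
  rw [Finset.prod_univ_sum, Fintype.piFinset_univ]

theorem tp_one : tp (fun j => (1 : Matrix (α j) (α j) ℂ)) = 1 := by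
  ext x y
  simp only [tp_apply, Matrix.one_apply]
  rw [Finset.prod_ite_zero]
  simp [funext_iff]

theorem tp_ct (M : ∀ j, Matrix (α j) (β j) ℂ) : (tp M)ᴴ = tp (fun j => (M j)ᴴ) := by
  ext x y
  simp [tp_apply, Matrix.conjTranspose_apply]

theorem tp_unitary {M : ∀ j, Matrix (α j) (β j) ℂ} (h : ∀ j, IsUnitaryMat (M j)) :
    IsUnitaryMat (tp M) := by
  refine ⟨?_, ?_⟩
  · rw [tp_ct, tp_mul, ← tp_one]; congr 1; funext j; exact (h j).1
  · rw [tp_ct, tp_mul, ← tp_one]; congr 1; funext j; exact (h j).2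

theorem tp_single (x y : ∀ j, α j) :
    tp (fun j => Matrix.single (x j) (y j) (1 : ℂ)) = Matrix.single x y 1 := by
  ext a b
  simp only [tp_apply, Matrix.single_apply]
  rw [Finset.prod_ite_zero]
  simp [funext_iff, forall_and]

/-- embedding at a site -/
def eps (j : J) : Matrix (α j) (α j) ℂ →⋆ₐ[ℂ] Matrix (∀ j, α j) (∀ j, α j) ℂ :=
  lft (Equiv.piSplitAt j α).symm

theorem eps_eq (j : J) (n : Matrix (α j) (α j) ℂ) :
    eps j n = tp (Function.update (fun j => (1 : Matrix (α j) (α j) ℂ)) j n) := by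
  ext x y
  rw [eps, lft_apply, tp_apply, ← Finset.mul_prod_erase _ _ (Finset.mem_univ j)]
  simp only [Equiv.symm_symm, Equiv.piSplitAt_apply, Function.update_self]
  congr 1
  rw [Finset.prod_congr rfl (g := fun i => if x i = y i then (1:ℂ) else 0)]
  · rw [Finset.prod_ite_zero]
    simp [funext_iff]
  · intro i hi
    rw [Function.update_of_ne (Finset.ne_of_mem_erase hi), Matrix.one_apply]

theorem comm_tp {R : Type*} [Monoid R] (φ : Matrix (∀ j, α j) (∀ j, α j) ℂ →* R) (X : R)
    (h : ∀ j c, Commute X (φ (eps j c))) (M : ∀ j, Matrix (α j) (α j) ℂ) :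
    Commute X (φ (tp M)) := by
  have key : ∀ S : Finset J, Commute X (φ (tp fun j => if j ∈ S then M j else 1)) := by
    intro S
    induction S using Finset.induction_on with
    | empty => simp [tp_one]
    | insert j S hj ih =>
      have : (tp fun i => if i ∈ insert j S then M i else 1) =
          eps j (M j) * tp fun i => if i ∈ S then M i else 1 := by
        rw [eps_eq, tp_mul]
        congr 1
        funext i
        by_cases hi : i = j
        · subst hi; simp [hj]
        · simp [hi]
      rw [this, map_mul]
      exact (h _ _).mul_right ih
  simpa using key Finset.univ

theorem tp_kron (M : ∀ j, Matrix (α j) (α j) ℂ) (N : ∀ j, Matrix (β j) (β j) ℂ) (x x' y y') :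
    tp (fun j => M j ⊗ₖ N j) (fun j => (x j, y j)) (fun j => (x' j, y' j)) =
      (tp M ⊗ₖ tp N) (x, y) (x', y') := by
  simp [tp_apply, Finset.prod_mul_distrib]

end tensor

theorem comm_scalar {γ : Type*} [Fintype γ] [DecidableEq γ] (X : Matrix γ γ ℂ)
    (h : ∀ x y, Commute X (Matrix.single x y 1)) : ∃ μ : ℂ, X = μ • 1 := by
  obtain ⟨μ, hμ⟩ := Matrix.mem_range_scalar_of_commute_single (M := X) (fun x y _ => (h x y).symm)
  refine ⟨μ, ?_⟩
  rw [← hμ, Matrix.smul_one_eq_diagonal]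
  rfl

theorem comm_left {C D : Type*} [Fintype C] [DecidableEq C] [Fintype D] [DecidableEq D]
    [Nonempty C] (M : Matrix (C × D) (C × D) ℂ)
    (h : ∀ d d', Commute M (Matrix.single d d' 1 ⊗ₖ (1 : Matrix D D ℂ))) :
    ∃ n : Matrix D D ℂ, M = (1 : Matrix C C ℂ) ⊗ₖ n := by
  obtain ⟨d0⟩ := ‹Nonempty C›
  refine ⟨Matrix.of fun c c' => M (d0, c) (d0, c'), ?_⟩
  ext ⟨x, c⟩ ⟨y, c'⟩
  have := congrFun (congrFun (h y d0).eq (x, c)) (d0, c')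
  simp only [Matrix.mul_apply, Matrix.kroneckerMap_apply, Fintype.sum_prod_type, Matrix.one_apply,
    Matrix.single_apply] at this
  simp only [Matrix.kroneckerMap_apply, Matrix.of_apply, Matrix.one_apply]
  simpa [ite_and, Finset.sum_ite_irrel, eq_comm] using this

open scoped Kronecker
set_option linter.unusedSectionVars false

section core
variable {F F' A B : Type*} [Fintype A] [DecidableEq A] [Fintype B] [DecidableEq B]
    [Fintype F] [DecidableEq F] [Fintype F'] [DecidableEq F']

theorem split_core [Nonempty F] [Nonempty F'] [Nonempty A] [Nonempty B]
    {Ut : Matrix (F × F') (A × B) ℂ} (hU : IsUnitaryMat Ut)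
    (θ : Matrix B B ℂ → Matrix F' F' ℂ)
    (hθ : ∀ b : Matrix B B ℂ, Ut * ((1 : Matrix A A ℂ) ⊗ₖ b) * Utᴴ = (1 : Matrix F F ℂ) ⊗ₖ θ b)
    (hx : ∀ x : Matrix F' F' ℂ, (∀ b, Commute x (θ b)) → ∃ μ : ℂ, x = μ • (1 : Matrix F' F' ℂ)) :
    ∃ (V : Matrix F A ℂ) (U' : Matrix F' B ℂ), IsUnitaryMat V ∧ IsUnitaryMat U' ∧
      ∀ f k a b, Ut (f, k) (a, b) = V f a * U' k b := by
  obtain ⟨f1⟩ := ‹Nonempty F›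
  obtain ⟨k1⟩ := ‹Nonempty F'›
  obtain ⟨a1⟩ := ‹Nonempty A›
  obtain ⟨b1⟩ := ‹Nonempty B›
  let T : F → A → Matrix F' B ℂ := fun f a => Matrix.of fun k b => Ut (f, k) (a, b)
  have hT : ∀ f a b, T f a * b = θ b * T f a := by
    intro f a b
    have h1 : Ut * ((1 : Matrix A A ℂ) ⊗ₖ b) = ((1 : Matrix F F ℂ) ⊗ₖ θ b) * Ut := by
      rw [← hθ b, Matrix.mul_assoc _ Utᴴ Ut, hU.2, Matrix.mul_one]
    ext k x
    have h2 := congrFun (congrFun h1 (f, k)) (a, x)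
    simpa [Matrix.mul_apply, Fintype.sum_prod_type, Matrix.one_apply, T, ite_mul, mul_ite] using h2
  have hθs : ∀ b, (θ b)ᴴ = θ bᴴ := by
    intro b
    have h1 := congrArg Matrix.conjTranspose (hθ b)
    rw [Matrix.conjTranspose_mul, Matrix.conjTranspose_mul, Matrix.conjTranspose_conjTranspose,
      Matrix.conjTranspose_kronecker, Matrix.conjTranspose_kronecker, Matrix.conjTranspose_one,
      Matrix.conjTranspose_one, ← Matrix.mul_assoc, hθ] at h1
    ext k k'
    have h2 := congrFun (congrFun h1 (f1, k)) (f1, k')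
    simpa using h2.symm
  have hTs : ∀ f a b, (T f a)ᴴ * θ b = b * (T f a)ᴴ := by
    intro f a b
    have h1 := congrArg Matrix.conjTranspose (hT f a bᴴ)
    rw [Matrix.conjTranspose_mul, Matrix.conjTranspose_mul, Matrix.conjTranspose_conjTranspose,
      hθs, Matrix.conjTranspose_conjTranspose] at h1
    exact h1.symm
  have hTT : ∀ f a f' a', ∃ μ : ℂ, (T f a)ᴴ * T f' a' = μ • (1 : Matrix B B ℂ) := by
    intro f a f' a'
    apply comm_scalar
    intro x y
    change _ * _ = _ * _
    rw [Matrix.mul_assoc, hT, ← Matrix.mul_assoc, hTs, Matrix.mul_assoc]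
  have h0 : ∃ f a, T f a ≠ 0 := by
    by_contra hcon
    push Not at hcon
    have : Ut = 0 := by
      ext ⟨f, k⟩ ⟨a, b⟩
      exact congrFun (congrFun (hcon f a) k) b
    have h1 := hU.1
    rw [this, Matrix.zero_mul] at h1
    have h2 := congrFun (congrFun h1 (f1, k1)) (f1, k1)
    simp at h2
  obtain ⟨f0, a0, hne⟩ := h0
  obtain ⟨s, hs⟩ := hTT f0 a0 f0 a0
  obtain ⟨μ, hμ⟩ := hx (T f0 a0 * (T f0 a0)ᴴ) (by
    intro b
    change _ * _ = _ * _
    rw [Matrix.mul_assoc, hTs, ← Matrix.mul_assoc, hT, Matrix.mul_assoc])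
  have hsμ : s = μ := by
    have h1 : T f0 a0 * ((T f0 a0)ᴴ * T f0 a0) = (T f0 a0 * (T f0 a0)ᴴ) * T f0 a0 := by
      rw [Matrix.mul_assoc]
    rw [hs, hμ, Matrix.mul_smul, Matrix.smul_mul, Matrix.mul_one, Matrix.one_mul] at h1
    exact smul_left_injective ℂ hne h1
  subst hsμ
  have hs0 : s ≠ 0 := by
    rintro rfl
    rw [zero_smul] at hs
    exact hne (Matrix.conjTranspose_mul_self_eq_zero.mp hs)
  obtain ⟨r, hr0, hr⟩ : ∃ r : ℝ, 0 ≤ r ∧ s = r := by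
    refine ⟨∑ k, Complex.normSq (T f0 a0 k b1), Finset.sum_nonneg fun _ _ => Complex.normSq_nonneg _, ?_⟩
    have h1 := congrFun (congrFun hs b1) b1
    simp only [Matrix.mul_apply, Matrix.conjTranspose_apply, Matrix.smul_apply, Matrix.one_apply_eq,
      smul_eq_mul, mul_one] at h1
    rw [← h1]
    push_cast
    refine Finset.sum_congr rfl fun k _ => ?_
    rw [Complex.normSq_eq_conj_mul_self]; rfl
  have hrne : r ≠ 0 := by rintro rfl; simp at hr; exact hs0 hr
  set q : ℂ := ((Real.sqrt r : ℝ) : ℂ)⁻¹ with hq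
  have hqs : star q = q := by simp [hq]
  have hqq : q * q * s = 1 := by
    rw [hq, ← mul_inv, ← Complex.ofReal_mul, Real.mul_self_sqrt hr0, hr]
    exact inv_mul_cancel₀ (by exact_mod_cast hrne)
  have hU' : IsUnitaryMat (q • T f0 a0) := by
    constructor
    · rw [Matrix.conjTranspose_smul, Matrix.smul_mul, Matrix.mul_smul, hμ, hqs, smul_smul, smul_smul,
        hqq, one_smul]
    · rw [Matrix.conjTranspose_smul, Matrix.smul_mul, Matrix.mul_smul, hs, hqs, smul_smul, smul_smul,
        hqq, one_smul]
  choose v hv using fun f a => hTT f0 a0 f a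
  have hfac : ∀ f k a b, Ut (f, k) (a, b) = (q * v f a) * (q • T f0 a0) k b := by
    intro f k a b
    have h1 : T f a = (q * v f a) • (q • T f0 a0) := by
      rw [← Matrix.one_mul (T f a), ← hU'.1, Matrix.conjTranspose_smul, Matrix.mul_assoc,
        Matrix.smul_mul _ _ (T f a), hv, hqs, Matrix.mul_smul, Matrix.mul_smul, Matrix.mul_one, smul_smul]
    exact congrFun (congrFun h1 k) b
  refine ⟨Matrix.of fun f a => q * v f a, q • T f0 a0, ⟨?_, ?_⟩, hU', hfac⟩
  · ext f f'
    have h1 := row_orth hU f k1 f' k1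
    have h2 := congrFun (congrFun hU'.1 k1) k1
    rw [Matrix.one_apply_eq, Matrix.mul_apply] at h2
    simp only [hfac] at h1
    rw [Matrix.mul_apply, Matrix.one_apply]
    simp only [and_true] at h1
    rw [← h1]
    refine Finset.sum_congr rfl fun a _ => ?_
    rw [← mul_one (_ * _), ← h2, Finset.mul_sum]
    refine Finset.sum_congr rfl fun b _ => ?_
    simp only [Matrix.conjTranspose_apply, Matrix.of_apply, star_mul']
    ring
  · ext a' a
    have h1 := col_orth hU a b1 a' b1
    have h2 := congrFun (congrFun hU'.2 b1) b1
    rw [Matrix.one_apply_eq, Matrix.mul_apply] at h2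
    simp only [hfac] at h1
    rw [Matrix.mul_apply, Matrix.one_apply]
    simp only [and_true] at h1
    rw [show (if a' = a then (1:ℂ) else 0) = if a = a' then 1 else 0 by simp [eq_comm], ← h1]
    refine Finset.sum_congr rfl fun a _ => ?_
    rw [← mul_one (_ * _), ← h2, Finset.mul_sum]
    refine Finset.sum_congr rfl fun b _ => ?_
    simp only [Matrix.conjTranspose_apply, Matrix.of_apply, star_mul']
    ring

end core

open scoped Kronecker
set_option linter.unusedSectionVars false

section zip
variable {J : Type*} [Fintype J] [DecidableEq J] {α β γ : J → Type*}
  [∀ j, Fintype (α j)] [∀ j, DecidableEq (α j)] [∀ j, Fintype (β j)] [∀ j, DecidableEq (β j)]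
  [∀ j, Fintype (γ j)] [∀ j, DecidableEq (γ j)]

/-- zipping tuples -/
def zipE (α β : J → Type*) : ((∀ j, α j) × (∀ j, β j)) ≃ (∀ j, α j × β j) where
  toFun p j := (p.1 j, p.2 j)
  invFun g := (fun j => (g j).1, fun j => (g j).2)
  left_inv _ := rfl
  right_inv _ := rfl

theorem submatrix_unitary {m n m' n' : Type*} [Fintype m] [DecidableEq m] [Fintype n]
    [DecidableEq n] [Fintype m'] [DecidableEq m'] [Fintype n'] [DecidableEq n']
    (e : m' ≃ m) (f : n' ≃ n) {M : Matrix m n ℂ} (h : IsUnitaryMat M) :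
    IsUnitaryMat (M.submatrix e f) := by
  constructor
  · rw [Matrix.conjTranspose_submatrix, Matrix.submatrix_mul_equiv, h.1, Matrix.submatrix_one_equiv]
  · rw [Matrix.conjTranspose_submatrix, Matrix.submatrix_mul_equiv, h.2, Matrix.submatrix_one_equiv]

theorem mul_unitary {m n k : Type*} [Fintype m] [DecidableEq m] [Fintype n]
    [DecidableEq n] [Fintype k] [DecidableEq k] {M : Matrix m n ℂ} {N : Matrix n k ℂ}
    (h : IsUnitaryMat M) (h' : IsUnitaryMat N) : IsUnitaryMat (M * N) := by
  constructor
  · rw [Matrix.conjTranspose_mul, Matrix.mul_assoc, ← Matrix.mul_assoc N, h'.1, Matrix.one_mul, h.1]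
  · rw [Matrix.conjTranspose_mul, Matrix.mul_assoc, ← Matrix.mul_assoc Mᴴ, h.2, Matrix.one_mul, h'.2]

/-- the zipped big isometry -/
def WW (W : ∀ j, Matrix (α j × β j) (γ j) ℂ) :
    Matrix ((∀ j, α j) × (∀ j, β j)) (∀ j, γ j) ℂ :=
  (tp W).submatrix (zipE α β) (Equiv.refl _)

theorem WW_unitary {W : ∀ j, Matrix (α j × β j) (γ j) ℂ} (h : ∀ j, IsUnitaryMat (W j)) :
    IsUnitaryMat (WW W) := submatrix_unitary _ _ (tp_unitary h)

theorem WW_tp (W : ∀ j, Matrix (α j × β j) (γ j) ℂ) (M : ∀ j, Matrix (γ j) (γ j) ℂ)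
    (P : ∀ j, Matrix (α j) (α j) ℂ) (Q : ∀ j, Matrix (β j) (β j) ℂ)
    (h : ∀ j, W j * M j * (W j)ᴴ = P j ⊗ₖ Q j) :
    WW W * tp M * (WW W)ᴴ = tp P ⊗ₖ tp Q := by
  have h1 : tp W * tp M * (tp W)ᴴ = tp (fun j => P j ⊗ₖ Q j) := by
    rw [tp_ct, tp_mul, tp_mul]; congr 1; funext j; exact h j
  ext ⟨x, y⟩ ⟨x', y'⟩
  rw [← tp_kron, ← h1]
  rfl

theorem WW_eps (W : ∀ j, Matrix (α j × β j) (γ j) ℂ) (h : ∀ j, IsUnitaryMat (W j)) (j : J)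
    (m : Matrix (α j) (α j) ℂ) :
    WW W * eps j ((W j)ᴴ * (m ⊗ₖ (1 : Matrix (β j) (β j) ℂ)) * W j) * (WW W)ᴴ =
      (eps j m) ⊗ₖ (1 : Matrix (∀ j, β j) (∀ j, β j) ℂ) := by
  rw [eps_eq, eps_eq, ← tp_one (α := β)]
  apply WW_tp
  intro i
  by_cases hij : i = j
  · subst hij
    rw [Function.update_self, Function.update_self]
    rw [Matrix.mul_assoc _ _ (W i), ← Matrix.mul_assoc (W i), (h i).1, Matrix.one_mul,
      Matrix.mul_assoc, (h i).1, Matrix.mul_one]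
  · rw [Function.update_of_ne hij, Function.update_of_ne hij, Matrix.mul_one, (h i).1,
      Matrix.one_kronecker_one]

theorem eps_inj [∀ j, Nonempty (γ j)] (j : J) (M : Matrix (γ j) (γ j) ℂ) (h : eps j M = 0) :
    M = 0 := by
  ext p q
  have r : ∀ k : {k // k ≠ j}, γ k := fun k => Classical.arbitrary _
  have := congrFun (congrFun h ((Equiv.piSplitAt j γ).symm (p, r))) ((Equiv.piSplitAt j γ).symm (q, r))
  rw [eps, lft_apply] at this
  simp only [Equiv.symm_apply_apply, if_true, mul_one] at this
  exact this

end zip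

section assembly
variable {J : Type*} [Fintype J] [DecidableEq J] {γ : J → Type*}
  [∀ j, Fintype (γ j)] [∀ j, DecidableEq (γ j)]
  {A B : Type*} [Fintype A] [DecidableEq A] [Fintype B] [DecidableEq B]

/-- the Heisenberg-evolved operator of the second input -/
def bh (U : Matrix (∀ j, γ j) (A × B) ℂ) (b : Matrix B B ℂ) : Matrix (∀ j, γ j) (∀ j, γ j) ℂ :=
  U * ((1 : Matrix A A ℂ) ⊗ₖ b) * Uᴴ

/-- algebra of local operators commuting with `bh` -/
def algN (U : Matrix (∀ j, γ j) (A × B) ℂ) (j : J) : Subalgebra ℂ (Matrix (γ j) (γ j) ℂ) :=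
  (Subalgebra.centralizer ℂ (Set.range (bh U))).comap (eps j).toAlgHom

theorem mem_algN (U : Matrix (∀ j, γ j) (A × B) ℂ) (j : J) (x : Matrix (γ j) (γ j) ℂ) :
    x ∈ algN U j ↔ ∀ b, Commute (eps j x) (bh U b) := by
  unfold algN
  rw [Subalgebra.mem_comap, Subalgebra.mem_centralizer_iff]
  constructor
  · intro h b
    exact (h (bh U b) ⟨b, rfl⟩).symm
  · rintro h _ ⟨b, rfl⟩
    exact (h b).symm

theorem bh_star (U : Matrix (∀ j, γ j) (A × B) ℂ) (b : Matrix B B ℂ) : (bh U b)ᴴ = bh U bᴴ := by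
  unfold bh
  rw [Matrix.conjTranspose_mul, Matrix.conjTranspose_mul, Matrix.conjTranspose_conjTranspose,
      Matrix.conjTranspose_kronecker, Matrix.conjTranspose_one, ← Matrix.mul_assoc]

theorem assembly [∀ j, Nonempty (γ j)] [Nonempty A] [Nonempty B]
    {U : Matrix (∀ j, γ j) (A × B) ℂ} (hU : IsUnitaryMat U)
    (hst : ∀ j (c c' : γ j), ∃ (n : γ j → Matrix (γ j) (γ j) ℂ) (β : γ j → Matrix B B ℂ),
      (∀ c1 b, Commute (eps j (n c1)) (bh U b)) ∧
      eps j (Matrix.single c c' 1) = ∑ c1, eps j (n c1) * bh U (β c1)) :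
    ∃ (e e' : J → ℕ) (W : ∀ j, Matrix (Fin (e j) × Fin (e' j)) (γ j) ℂ)
      (V : Matrix (∀ j, Fin (e j)) A ℂ) (U' : Matrix (∀ j, Fin (e' j)) B ℂ),
      (∀ j, IsUnitaryMat (W j)) ∧ IsUnitaryMat V ∧ IsUnitaryMat U' ∧
      ∀ f k a b, (WW W * U) (f, k) (a, b) = V f a * U' k b := by
  have hfac : ∀ j, ∃ (e e' : ℕ) (W : Matrix (Fin e × Fin e') (γ j) ℂ), IsUnitaryMat W ∧
      ∀ x, x ∈ algN U j ↔ ∃ m : Matrix (Fin e) (Fin e) ℂ, x = Wᴴ * (m ⊗ₖ (1 : Matrix (Fin e') (Fin e') ℂ)) * W := by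
    intro j
    apply factor
    · intro x hx
      rw [mem_algN] at hx ⊢
      intro b
      have h1 := (hx bᴴ).eq
      have h2 := congrArg Matrix.conjTranspose h1
      rw [Matrix.conjTranspose_mul, Matrix.conjTranspose_mul, bh_star,
        Matrix.conjTranspose_conjTranspose] at h2
      have h3 : eps j xᴴ = (eps j x)ᴴ := map_star (eps j) x
      rw [h3]
      exact h2.symm
    · intro x hx y hy hxy
      have hE : ∀ c c', x * Matrix.single c c' 1 * y = 0 := by
        intro c c'
        apply eps_inj
        obtain ⟨n, β, hn, hs⟩ := hst j c c'
        rw [map_mul, map_mul, hs, Matrix.mul_sum, Matrix.sum_mul]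
        apply Finset.sum_eq_zero
        intro c1 _
        have hy' := (((mem_algN U j y).mp hy) (β c1)).eq
        rw [mul_assoc, mul_assoc, ← hy', ← mul_assoc, ← mul_assoc, ← map_mul, ← map_mul,
          hxy (n c1) ((mem_algN U j _).mpr (hn c1)), map_zero, zero_mul]
      by_contra hcon
      push Not at hcon
      obtain ⟨hx0, hy0⟩ := hcon
      obtain ⟨i, c, hic⟩ : ∃ i c, x i c ≠ 0 := by
        by_contra h; push Not at h; exact hx0 (by ext i c; exact h i c)
      obtain ⟨c', k, hck⟩ : ∃ i c, y i c ≠ 0 := by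
        by_contra h; push Not at h; exact hy0 (by ext i c; exact h i c)
      have h1 := congrFun (congrFun (hE c c') i) k
      rw [Matrix.mul_apply, Finset.sum_eq_single c'] at h1
      · simp at h1
        tauto
      · intro z _ hz
        rw [Matrix.mul_single_apply_of_ne _ _ _ _ _ hz, zero_mul]
      · simp
  choose e e' W hW hN using hfac
  have hWW := WW_unitary hW
  have hUt := mul_unitary hWW hU
  have hcardG : 0 < Fintype.card ((∀ j, Fin (e j)) × (∀ j, Fin (e' j))) := by
    rw [unitary_card hWW]; exact Fintype.card_pos
  have hne := Fintype.card_pos_iff.mp hcardG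
  have hneF : Nonempty (∀ j, Fin (e j)) := hne.map Prod.fst
  have hneF' : Nonempty (∀ j, Fin (e' j)) := hne.map Prod.snd
  -- the conjugated operators
  have hconj : ∀ X Y : Matrix (∀ j, γ j) (∀ j, γ j) ℂ, Commute X Y →
      Commute (WW W * X * (WW W)ᴴ) (WW W * Y * (WW W)ᴴ) := by
    intro X Y h
    change _ * _ = _ * _
    rw [conj_mul hWW, conj_mul hWW, h.eq]
  have hcomm : ∀ b j (m : Matrix (Fin (e j)) (Fin (e j)) ℂ),
      Commute (WW W * bh U b * (WW W)ᴴ)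
        ((eps j m) ⊗ₖ (1 : Matrix (∀ j, Fin (e' j)) (∀ j, Fin (e' j)) ℂ)) := by
    intro b j m
    rw [← WW_eps W hW]
    apply hconj
    exact ((mem_algN U j _).mp ((hN j _).mpr ⟨m, rfl⟩) b).symm
  have hθ : ∀ b, ∃ θ : Matrix (∀ j, Fin (e' j)) (∀ j, Fin (e' j)) ℂ,
      WW W * bh U b * (WW W)ᴴ = (1 : Matrix (∀ j, Fin (e j)) (∀ j, Fin (e j)) ℂ) ⊗ₖ θ := by
    intro b
    apply comm_left
    intro x y
    have := comm_tp (lft (Equiv.refl ((∀ j, Fin (e j)) × (∀ j, Fin (e' j)))) :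
      _ →⋆ₐ[ℂ] _).toAlgHom.toMonoidHom (WW W * bh U b * (WW W)ᴴ)
      (fun j c => hcomm b j c) (fun j => Matrix.single (x j) (y j) 1)
    rw [tp_single] at this
    exact this
  choose θ hθ using hθ
  obtain ⟨V, U', hV, hU', hfin⟩ := split_core hUt θ (by
    intro b
    rw [← hθ b, Matrix.conjTranspose_mul]
    simp only [bh, Matrix.mul_assoc]) (by
    intro x hx
    set X := (WW W)ᴴ * ((1 : Matrix (∀ j, Fin (e j)) (∀ j, Fin (e j)) ℂ) ⊗ₖ x) * WW W with hX
    have hXc : WW W * X * (WW W)ᴴ = (1 : Matrix (∀ j, Fin (e j)) (∀ j, Fin (e j)) ℂ) ⊗ₖ x := by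
      rw [hX, Matrix.mul_assoc _ _ (WW W), ← Matrix.mul_assoc (WW W), hWW.1, Matrix.one_mul,
        Matrix.mul_assoc, hWW.1, Matrix.mul_one]
    have hback : ∀ Y, Commute (WW W * X * (WW W)ᴴ) (WW W * Y * (WW W)ᴴ) → Commute X Y := by
      intro Y h
      have h1 := h.eq
      rw [conj_mul hWW, conj_mul hWW] at h1
      have h2 := congrArg (fun M => (WW W)ᴴ * M * WW W) h1
      have h3 : ∀ Z : Matrix (∀ j, γ j) (∀ j, γ j) ℂ, (WW W)ᴴ * (WW W * Z * (WW W)ᴴ) * WW W = Z := by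
        intro Z
        rw [Matrix.mul_assoc (WW W), ← Matrix.mul_assoc (WW W)ᴴ, hWW.2, Matrix.one_mul,
          Matrix.mul_assoc, hWW.2, Matrix.mul_one]
      simp only [h3] at h2
      exact h2
    have hXb : ∀ b, Commute X (bh U b) := by
      intro b
      apply hback
      rw [hXc, hθ]
      change _ * _ = _ * _
      rw [← Matrix.mul_kronecker_mul, ← Matrix.mul_kronecker_mul, (hx b).eq]
    have hXN : ∀ j, ∀ y ∈ algN U j, Commute X (eps j y) := by
      intro j y hy
      obtain ⟨m, rfl⟩ := (hN j y).mp hy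
      apply hback
      rw [hXc, WW_eps W hW]
      change _ * _ = _ * _
      rw [← Matrix.mul_kronecker_mul, ← Matrix.mul_kronecker_mul, Matrix.one_mul, Matrix.mul_one,
        Matrix.one_mul, Matrix.mul_one]
    have hXE : ∀ j (c : Matrix (γ j) (γ j) ℂ), Commute X (eps j c) := by
      intro j c
      rw [Matrix.matrix_eq_sum_single c, map_sum]
      refine Commute.sum_right _ _ _ fun c1 _ => ?_
      rw [map_sum]
      refine Commute.sum_right _ _ _ fun c2 _ => ?_
      rw [show Matrix.single c1 c2 (c c1 c2) = c c1 c2 • Matrix.single c1 c2 (1 : ℂ) by simp, map_smul]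
      apply Commute.smul_right
      obtain ⟨n, β, hn, hs⟩ := hst j c1 c2
      rw [hs]
      refine Commute.sum_right _ _ _ fun c3 _ => ?_
      exact (hXN j _ ((mem_algN U j _).mpr (hn c3))).mul_right (hXb _)
    have hXs : ∃ μ : ℂ, X = μ • 1 := by
      apply comm_scalar
      intro x y
      rw [← tp_single]
      exact comm_tp (MonoidHom.id _) X hXE _
    obtain ⟨μ, hμ⟩ := hXs
    refine ⟨μ, ?_⟩
    rw [hμ, Matrix.mul_smul, Matrix.smul_mul, Matrix.mul_one, hWW.1] at hXc
    obtain ⟨f⟩ := hneF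
    ext k k'
    have := congrFun (congrFun hXc (f, k)) (f, k')
    simp only [Matrix.smul_apply, Matrix.one_apply, Matrix.kroneckerMap_apply, Prod.mk.injEq,
      true_and, if_true, one_mul] at this ⊢
    exact this.symm)
  exact ⟨e, e', W, V, U', hW, hV, hU', hfin⟩

end assembly

open scoped Kronecker
set_option linter.unusedSectionVars false

section SmL
variable {K : Type*} [Fintype K] [DecidableEq K] {F : K → Type*}
  [∀ k, Fintype (F k)] [∀ k, DecidableEq (F k)]

theorem Sm_split {X Y : Type*} [Fintype X] [DecidableEq X] [Fintype Y] [DecidableEq Y]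
    [Nonempty X] [Nonempty Y] (S : Finset K) (ψ : (∀ k, F k) → ℂ) (z : X × Y ≃ (∀ k, F k))
    (h1 : ∀ k, k ∈ S → ∀ x y y', z (x, y) k = z (x, y') k)
    (h2 : ∀ k, k ∉ S → ∀ x x' y, z (x, y) k = z (x', y) k)
    (M : Matrix X Y ℂ) (hM : ∀ x y, M x y = ψ (z (x, y))) :
    Sm S ψ = vNE (M * Mᴴ) := by
  obtain ⟨x0⟩ := ‹Nonempty X›
  obtain ⟨y0⟩ := ‹Nonempty Y›
  let Mc : Matrix (∀ k : {a // a ∈ S}, F k.val) (∀ k : {a // a ∈ Sᶜ}, F k.val) ℂ :=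
    Matrix.of fun x y => ψ (fun k => if h : k ∈ S then x ⟨k, h⟩ else y ⟨k, Finset.mem_compl.mpr h⟩)
  have hm : marg S ψ = Mc * Mcᴴ := by
    ext x x'
    simp [marg, Matrix.mul_apply, Mc]
  let fX : X → (∀ k : {a // a ∈ S}, F k.val) := fun x k => z (x, y0) k.1
  let fY : Y → (∀ k : {a // a ∈ Sᶜ}, F k.val) := fun y k => z (x0, y) k.1
  have bX : Function.Bijective fX := by
    constructor
    · intro x x' h
      have : z (x, y0) = z (x', y0) := by
        funext k
        by_cases hk : k ∈ S
        · exact congrFun h ⟨k, hk⟩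
        · exact h2 k hk _ _ _
      exact congrArg Prod.fst (z.injective this)
    · intro s
      let g : ∀ k, F k := fun k => if h : k ∈ S then s ⟨k, h⟩ else z (x0, y0) k
      refine ⟨(z.symm g).1, ?_⟩
      funext ⟨k, hk⟩
      change z ((z.symm g).1, y0) k = _
      rw [h1 k hk _ y0 (z.symm g).2, Prod.mk.eta, Equiv.apply_symm_apply]
      simp [g, hk]
  have bY : Function.Bijective fY := by
    constructor
    · intro x x' h
      have : z (x0, x) = z (x0, x') := by
        funext k
        by_cases hk : k ∈ S
        · exact h1 k hk _ _ _
        · exact congrFun h ⟨k, Finset.mem_compl.mpr hk⟩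
      exact congrArg Prod.snd (z.injective this)
    · intro s
      let g : ∀ k, F k := fun k => if h : k ∈ S then z (x0, y0) k else s ⟨k, Finset.mem_compl.mpr h⟩
      refine ⟨(z.symm g).2, ?_⟩
      funext ⟨k, hk⟩
      have hk' := Finset.mem_compl.mp hk
      change z (x0, (z.symm g).2) k = _
      rw [h2 k hk' _ (z.symm g).1, Prod.mk.eta, Equiv.apply_symm_apply]
      simp [g, hk']
  have hMs : M = Mc.submatrix (Equiv.ofBijective fX bX) (Equiv.ofBijective fY bY) := by
    ext x y
    rw [hM]
    change _ = ψ _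
    congr 1
    funext k
    by_cases hk : k ∈ S
    · simp only [hk, dif_pos]
      exact h1 k hk _ _ _
    · simp only [hk, dif_neg, not_false_eq_true]
      exact h2 k hk _ _ _
  rw [Sm, hm, hMs, vNE_reindex]

end SmL

theorem vNE_flat' {X Y : Type*} [Fintype X] [DecidableEq X] [Fintype Y] [DecidableEq Y] [Nonempty X]
    (M : Matrix X Y ℂ)
    (h : ∀ x x', ∑ y, M x y * star (M x' y) = if x = x' then (Fintype.card X : ℂ)⁻¹ else 0) :
    vNE (M * Mᴴ) = Real.log (Fintype.card X) / Real.log 2 := by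
  apply vNE_flat
  ext x x'
  rw [Matrix.mul_apply]
  simp only [Matrix.conjTranspose_apply, h, Matrix.smul_apply, Matrix.one_apply, smul_eq_mul,
    mul_ite, mul_one, mul_zero]

section iface
variable {I J : Type*} [Fintype I] [Fintype J] [DecidableEq I] [DecidableEq J]
    {FA : I → Type u} {FC : J → Type u}
    [∀ i, Fintype (FA i)] [∀ j, Fintype (FC j)]
    [∀ i, DecidableEq (FA i)] [∀ j, DecidableEq (FC j)]
    {A B C D : Type*} [Fintype A] [DecidableEq A] [Fintype B] [DecidableEq B]
    [Fintype C] [DecidableEq C] [Fintype D] [DecidableEq D]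

/-- four-fold splitting of the index set -/
def z4 (eA : A × B ≃ (∀ i, FA i)) (eC : C × D ≃ (∀ j, FC j)) :
    (A × B) × (C × D) ≃ (∀ k : I ⊕ J, Sum.elim FA FC k) :=
  (Equiv.prodCongr eA eC).trans (Equiv.sumPiEquivProdPi (fun k => Sum.elim FA FC k)).symm

theorem z4_inl (eA : A × B ≃ (∀ i, FA i)) (eC : C × D ≃ (∀ j, FC j)) (p q i) :
    z4 eA eC (p, q) (Sum.inl i) = eA p i := rfl

theorem z4_inr (eA : A × B ≃ (∀ i, FA i)) (eC : C × D ≃ (∀ j, FC j)) (p q j) :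
    z4 eA eC (p, q) (Sum.inr j) = eC q j := rfl

theorem mChoi_z4 (eA : A × B ≃ (∀ i, FA i)) (eC : C × D ≃ (∀ j, FC j))
    (U : Matrix (∀ j, FC j) (∀ i, FA i) ℂ) (a b c d) :
    mChoi U (z4 eA eC ((a, b), (c, d))) = chi (U.submatrix eC eA) a b c d := by
  unfold mChoi chi
  rw [Fintype.card_congr eA]
  congr!

theorem I3_iff [Nonempty A] [Nonempty B] [Nonempty C] [Nonempty D]
    (eA : A × B ≃ (∀ i, FA i)) (eC : C × D ≃ (∀ j, FC j)) (i : I) (j : J)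
    (hA1 : ∀ a b b', eA (a, b) i = eA (a, b') i)
    (hA2 : ∀ i', i' ≠ i → ∀ a a' b, eA (a, b) i' = eA (a', b) i')
    (hC1 : ∀ a b b', eC (a, b) j = eC (a, b') j)
    (hC2 : ∀ i', i' ≠ j → ∀ a a' b, eC (a, b) i' = eC (a', b) i')
    (U : Matrix (∀ j, FC j) (∀ i, FA i) ℂ) (hU : IsUnitaryMat U) :
    I3m ({Sum.inl i} : Finset (I ⊕ J)) ((Finset.univ.erase i).image Sum.inl)
      ({Sum.inr j} : Finset (I ⊕ J)) (mChoi U) = 0 ↔ PCond (U.submatrix eC eA) := by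
  set Us := U.submatrix eC eA with hUs
  have hUu : IsUnitaryMat Us := submatrix_unitary eC eA hU
  have hcard : (Fintype.card (A × B) : ℝ) = Fintype.card C * Fintype.card D := by
    rw [← unitary_card hUu, Fintype.card_prod]; push_cast; rfl
  have hcard' : (Fintype.card (A × B) : ℝ) = Fintype.card A * Fintype.card B := by
    rw [Fintype.card_prod]; push_cast; rfl
  have pA : (Fintype.card A : ℝ) ≠ 0 := by exact_mod_cast Fintype.card_ne_zero
  have pB : (Fintype.card B : ℝ) ≠ 0 := by exact_mod_cast Fintype.card_ne_zero
  have pC : (Fintype.card C : ℝ) ≠ 0 := by exact_mod_cast Fintype.card_ne_zero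
  have pD : (Fintype.card D : ℝ) ≠ 0 := by exact_mod_cast Fintype.card_ne_zero
  let zz := z4 eA eC
  -- S(A_i)
  have s1 : Sm ({Sum.inl i} : Finset (I ⊕ J)) (mChoi U) =
      Real.log (Fintype.card A) / Real.log 2 := by
    let w : A × (B × (C × D)) ≃ (A × B) × (C × D) := (Equiv.prodAssoc _ _ _).symm
    rw [Sm_split _ _ (w.trans zz) ?_ ?_ (Matrix.of fun a q => chi Us a q.1 q.2.1 q.2.2) ?_]
    · apply vNE_flat'
      intro x x'
      rw [← flatA hUu x x']
      simp only [Matrix.of_apply, Fintype.sum_prod_type]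
      rw [Finset.sum_comm]
      refine Finset.sum_congr rfl fun c _ => ?_
      rw [Finset.sum_comm]
    · rintro (k | k) hk x ⟨b, c, d⟩ ⟨b', c', d'⟩
      · simp at hk; subst hk; exact hA1 _ _ _
      · simp at hk
    · rintro (k | k) hk x x' ⟨b, c, d⟩
      · simp at hk; exact hA2 _ hk _ _ _
      · rfl
    · rintro a ⟨b, c, d⟩
      exact (mChoi_z4 eA eC U a b c d).symm
  -- S(A_i^c)
  have s2 : Sm ((Finset.univ.erase i).image Sum.inl : Finset (I ⊕ J)) (mChoi U) =
      Real.log (Fintype.card B) / Real.log 2 := by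
    let w : B × (A × (C × D)) ≃ (A × B) × (C × D) :=
      ⟨fun p => ((p.2.1, p.1), p.2.2), fun p => (p.1.2, (p.1.1, p.2)), fun _ => rfl, fun _ => rfl⟩
    rw [Sm_split _ _ (w.trans zz) ?_ ?_ (Matrix.of fun b q => chi Us q.1 b q.2.1 q.2.2) ?_]
    · apply vNE_flat'
      intro x x'
      rw [← flatB hUu x x']
      simp only [Matrix.of_apply, Fintype.sum_prod_type]
      rw [Finset.sum_comm]
      refine Finset.sum_congr rfl fun c _ => ?_
      rw [Finset.sum_comm]
    · rintro (k | k) hk x ⟨b, c, d⟩ ⟨b', c', d'⟩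
      · simp at hk; exact hA2 _ hk _ _ _
      · simp at hk
    · rintro (k | k) hk x x' ⟨b, c, d⟩
      · simp at hk; subst hk; exact hA1 _ _ _
      · rfl
    · rintro b ⟨a, c, d⟩
      exact (mChoi_z4 eA eC U a b c d).symm
  -- S(A)
  have s3 : Sm (({Sum.inl i} : Finset (I ⊕ J)) ∪ (Finset.univ.erase i).image Sum.inl) (mChoi U) =
      Real.log (Fintype.card (A × B)) / Real.log 2 := by
    rw [Sm_split _ _ zz ?_ ?_ (Matrix.of fun p q => chi Us p.1 p.2 q.1 q.2) ?_]
    · apply vNE_flat'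
      rintro ⟨a, b⟩ ⟨a', b'⟩
      simp only [Matrix.of_apply, Fintype.sum_prod_type, chi_chi, ← Finset.mul_sum, col_orth hUu]
      simp only [Prod.mk.injEq, mul_ite, mul_one, mul_zero]
    · rintro (k | k) hk ⟨a, b⟩ ⟨c, d⟩ ⟨c', d'⟩
      · rfl
      · simp at hk
    · rintro (k | k) hk ⟨a, b⟩ ⟨a', b'⟩ ⟨c, d⟩
      · simp at hk
      · rfl
    · rintro ⟨a, b⟩ ⟨c, d⟩
      exact (mChoi_z4 eA eC U a b c d).symm
  -- S(C_j)
  have s4 : Sm ({Sum.inr j} : Finset (I ⊕ J)) (mChoi U) =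
      Real.log (Fintype.card C) / Real.log 2 := by
    let w : C × (A × (B × D)) ≃ (A × B) × (C × D) :=
      ⟨fun p => ((p.2.1, p.2.2.1), (p.1, p.2.2.2)), fun p => (p.2.1, (p.1.1, p.1.2, p.2.2)),
        fun _ => rfl, fun _ => rfl⟩
    rw [Sm_split _ _ (w.trans zz) ?_ ?_ (Matrix.of fun c q => chi Us q.1 q.2.1 c q.2.2) ?_]
    · apply vNE_flat'
      intro x x'
      rw [← flatC hUu x x']
      simp only [Matrix.of_apply, Fintype.sum_prod_type]
    · rintro (k | k) hk x ⟨b, c, d⟩ ⟨b', c', d'⟩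
      · simp at hk
      · simp at hk; subst hk; exact hC1 _ _ _
    · rintro (k | k) hk x x' ⟨b, c, d⟩
      · rfl
      · simp at hk; exact hC2 _ hk _ _ _
    · rintro c ⟨a, b, d⟩
      exact (mChoi_z4 eA eC U a b c d).symm
  -- S(A_i C_j)
  have s5 : Sm (({Sum.inl i} : Finset (I ⊕ J)) ∪ {Sum.inr j}) (mChoi U) =
      vNE (mAC Us * (mAC Us)ᴴ) := by
    let w : (A × C) × (B × D) ≃ (A × B) × (C × D) := Equiv.prodProdProdComm A C B D
    refine Sm_split _ _ (w.trans zz) ?_ ?_ _ ?_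
    · rintro (k | k) hk ⟨a, c⟩ ⟨b, d⟩ ⟨b', d'⟩
      · simp at hk; subst hk; exact hA1 _ _ _
      · simp at hk; subst hk; exact hC1 _ _ _
    · rintro (k | k) hk ⟨a, c⟩ ⟨a', c'⟩ ⟨b, d⟩
      · simp at hk; exact hA2 _ hk _ _ _
      · simp at hk; exact hC2 _ hk _ _ _
    · rintro ⟨a, c⟩ ⟨b, d⟩
      exact (mChoi_z4 eA eC U a b c d).symm
  -- S(A_i^c C_j)
  have s6 : Sm ((Finset.univ.erase i).image Sum.inl ∪ ({Sum.inr j} : Finset (I ⊕ J))) (mChoi U) =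
      vNE (mAD Us * (mAD Us)ᴴ) := by
    let w : (B × C) × (A × D) ≃ (A × B) × (C × D) :=
      ⟨fun p => ((p.2.1, p.1.1), (p.1.2, p.2.2)), fun p => ((p.1.2, p.2.1), (p.1.1, p.2.2)),
        fun _ => rfl, fun _ => rfl⟩
    rw [vNE_compl]
    refine Sm_split _ _ (w.trans zz) ?_ ?_ _ ?_
    · rintro (k | k) hk ⟨a, c⟩ ⟨b, d⟩ ⟨b', d'⟩
      · simp at hk; exact hA2 _ hk _ _ _
      · simp at hk; subst hk; exact hC1 _ _ _
    · rintro (k | k) hk ⟨a, c⟩ ⟨a', c'⟩ ⟨b, d⟩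
      · simp at hk; subst hk; exact hA1 _ _ _
      · simp at hk; exact hC2 _ hk _ _ _
    · rintro ⟨b, c⟩ ⟨a, d⟩
      exact (mChoi_z4 eA eC U a b c d).symm
  -- S(A C_j)
  have s7 : Sm (({Sum.inl i} : Finset (I ⊕ J)) ∪ ((Finset.univ.erase i).image Sum.inl ∪ {Sum.inr j}))
      (mChoi U) = Real.log (Fintype.card D) / Real.log 2 := by
    let w : (A × (B × C)) × D ≃ (A × B) × (C × D) :=
      ⟨fun p => ((p.1.1, p.1.2.1), (p.1.2.2, p.2)), fun p => ((p.1.1, (p.1.2, p.2.1)), p.2.2),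
        fun _ => rfl, fun _ => rfl⟩
    rw [Sm_split _ _ (w.trans zz) ?_ ?_ (Matrix.of fun p d => chi Us p.1 p.2.1 p.2.2 d) ?_]
    · rw [vNE_compl]
      apply vNE_flat'
      intro x x'
      rw [← flatD hUu x x']
      simp only [Matrix.of_apply, Fintype.sum_prod_type, Matrix.transpose_apply]
    · rintro (k | k) hk ⟨a, b, c⟩ d d'
      · rfl
      · simp at hk; subst hk; exact hC1 _ _ _
    · rintro (k | k) hk ⟨a, b, c⟩ ⟨a', b', c'⟩ d
      · simp at hk
      · simp at hk; exact hC2 _ hk _ _ _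
    · rintro ⟨a, b, c⟩ d
      exact (mChoi_z4 eA eC U a b c d).symm
  unfold I3m Im PCond
  rw [s1, s2, s3, s4, s5, s6, s7, hcard']
  have e1 : Real.log (Fintype.card A * Fintype.card B : ℝ) =
      Real.log (Fintype.card C) + Real.log (Fintype.card D) := by
    rw [← hcard', hcard, Real.log_mul pC pD]
  have e2 : Real.log (Fintype.card A * Fintype.card B : ℝ) =
      Real.log (Fintype.card A) + Real.log (Fintype.card B) := Real.log_mul pA pB
  have e3 : Real.log (Fintype.card A * Fintype.card B : ℝ) / Real.log 2 =
      Real.log (Fintype.card C) / Real.log 2 + Real.log (Fintype.card D) / Real.log 2 := by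
    rw [e1, add_div]
  have e4 : Real.log (Fintype.card A * Fintype.card B : ℝ) / Real.log 2 =
      Real.log (Fintype.card A) / Real.log 2 + Real.log (Fintype.card B) / Real.log 2 := by
    rw [e2, add_div]
  constructor <;> intro h <;> linarith

end iface

open scoped Kronecker
set_option linter.unusedSectionVars false

section peel
variable {G A H C D C' D' Fc Fd : Type*} [Fintype G] [DecidableEq G] [Fintype A] [DecidableEq A]
    [Fintype H] [DecidableEq H] [Fintype C] [DecidableEq C] [Fintype D] [DecidableEq D]
    [Fintype C'] [DecidableEq C'] [Fintype D'] [DecidableEq D']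
    [Fintype Fc] [DecidableEq Fc] [Fintype Fd] [DecidableEq Fd]

theorem kron_step [Nonempty Fc] [Nonempty Fd] (P : Matrix (G × C) ((A × H) × D) ℂ)
    (P' : Matrix (G × C') (H × D') ℂ)
    (Wc : Matrix (Fc × C') C ℂ) (Wd : Matrix (Fd × D') D ℂ) (V : Matrix (Fc × Fd) A ℂ)
    (hc : IsUnitaryMat Wc) (hd : IsUnitaryMat Wd) (hV : IsUnitaryMat V)
    (htr : trace (P' * P'ᴴ) = 1)
    (hrel : ∀ fc c' fd d' g a h, ∑ c, ∑ d, Wc (fc, c') c * P (g, c) ((a, h), d) * Wd (fd, d') d =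
      (Real.sqrt (Fintype.card A) : ℂ)⁻¹ * V (fc, fd) a * P' (g, c') (h, d')) :
    vNE (P * Pᴴ) = vNE (P' * P'ᴴ) + Real.log (Fintype.card Fc) / Real.log 2 := by
  let Q : Matrix (G × (Fc × C')) (G × C) ℂ := (1 : Matrix G G ℂ) ⊗ₖ Wc
  let R : Matrix ((A × H) × D) ((A × H) × (Fd × D')) ℂ := (1 : Matrix (A × H) (A × H) ℂ) ⊗ₖ Wdᵀ
  have hQ : Qᴴ * Q = 1 := by
    simp only [Q]
    rw [Matrix.conjTranspose_kronecker, ← Matrix.mul_kronecker_mul, hc.2, Matrix.conjTranspose_one,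
      Matrix.one_mul, Matrix.one_kronecker_one]
  have hR : R * Rᴴ = 1 := by
    simp only [R]
    rw [Matrix.conjTranspose_kronecker, ← Matrix.mul_kronecker_mul, Matrix.conjTranspose_one,
      Matrix.one_mul]
    have : Wdᵀ * Wdᵀᴴ = 1 := by
      have h1 := congrArg Matrix.transpose hd.2
      rw [Matrix.transpose_mul, Matrix.transpose_one] at h1
      exact h1
    rw [this, Matrix.one_kronecker_one]
  have hN : ∀ g fc c' a h fd d', (Q * P * R) (g, (fc, c')) ((a, h), (fd, d')) =
      (Real.sqrt (Fintype.card A) : ℂ)⁻¹ * V (fc, fd) a * P' (g, c') (h, d') := by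
    intro g fc c' a h fd d'
    rw [← hrel]
    simp only [Q, R, Matrix.mul_apply, Fintype.sum_prod_type, Matrix.kroneckerMap_apply,
      Matrix.one_apply, Matrix.transpose_apply]
    rw [Finset.sum_eq_single a, Finset.sum_eq_single h]
    · rw [Finset.sum_comm]
      refine Finset.sum_congr rfl fun d _ => ?_
      rw [Finset.sum_eq_single g]
      · simp [Finset.sum_mul]
      · intro g' _ hg; simp [hg.symm]
      · simp
    · intro h' _ hh; simp [hh]
    · simp
    · intro a' _ ha; simp [ha]
    · simp
  have hcard : (Fintype.card A : ℂ) = Fintype.card Fc * Fintype.card Fd := by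
    rw [← unitary_card hV, Fintype.card_prod]; push_cast; rfl
  have pF : (Fintype.card Fc : ℂ) ≠ 0 := by exact_mod_cast Fintype.card_ne_zero
  have pF' : (Fintype.card Fd : ℂ) ≠ 0 := by exact_mod_cast Fintype.card_ne_zero
  have hq : (Real.sqrt (Fintype.card A) : ℂ)⁻¹ * (Real.sqrt (Fintype.card A) : ℂ)⁻¹ =
      (Fintype.card A : ℂ)⁻¹ := by
    rw [← mul_inv, ← Complex.ofReal_mul, Real.mul_self_sqrt (by positivity)]
    push_cast; rfl
  let w : Fc × (G × C') ≃ G × (Fc × C') :=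
    ⟨fun p => (p.2.1, (p.1, p.2.2)), fun p => (p.2.1, (p.1, p.2.2)), fun _ => rfl, fun _ => rfl⟩
  have hvv : ∀ fc fc', ∑ fd, ∑ a, V (fc, fd) a * star (V (fc', fd) a) =
      if fc = fc' then (Fintype.card Fd : ℂ) else 0 := by
    intro fc fc'
    have : ∀ fd, ∑ a, V (fc, fd) a * star (V (fc', fd) a) = if fc = fc' then 1 else 0 := by
      intro fd
      have := congrFun (congrFun hV.1 (fc, fd)) (fc', fd)
      simpa [Matrix.mul_apply, Matrix.one_apply] using this
    simp only [this]
    split_ifs <;> simp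
  have hρ : ((Q * P * R) * (Q * P * R)ᴴ).submatrix w w = Matrix.of fun (p q : Fc × (G × C')) =>
      (if p.1 = q.1 then (Fintype.card Fc : ℂ)⁻¹ else 0) * (P' * P'ᴴ) p.2 q.2 := by
    ext ⟨fc, g, c⟩ ⟨fc', g', c'⟩
    have e1 : ((Q * P * R) * (Q * P * R)ᴴ) (g, (fc, c)) (g', (fc', c')) =
        (Fintype.card A : ℂ)⁻¹ * ((∑ fd, ∑ a, V (fc, fd) a * star (V (fc', fd) a)) *
          (P' * P'ᴴ) (g, c) (g', c')) := by
      rw [Matrix.mul_apply, Matrix.mul_apply, ← hq]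
      simp only [Fintype.sum_prod_type, Matrix.conjTranspose_apply, hN, star_mul', star_inv₀,
        Complex.star_def, Complex.conj_ofReal]
      rw [Finset.sum_comm (s := (Finset.univ : Finset Fd)), Finset.sum_mul, Finset.mul_sum]
      refine Finset.sum_congr rfl fun a _ => ?_
      rw [Finset.mul_sum, Finset.mul_sum]
      refine Finset.sum_congr rfl fun h _ => ?_
      rw [Finset.sum_mul, Finset.mul_sum]
      refine Finset.sum_congr rfl fun fd _ => ?_
      rw [Finset.mul_sum, Finset.mul_sum]
      refine Finset.sum_congr rfl fun d' _ => ?_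
      ring
    change ((Q * P * R) * (Q * P * R)ᴴ) (g, (fc, c)) (g', (fc', c')) = _
    rw [e1, hvv, hcard]
    simp only [Matrix.of_apply]
    split_ifs
    · field_simp
    · simp
  have hρ1 : (Q * P * R) * (Q * P * R)ᴴ = Q * (P * Pᴴ) * Qᴴ := by
    rw [Matrix.conjTranspose_mul, Matrix.mul_assoc (Q * P), ← Matrix.mul_assoc R, hR, Matrix.one_mul,
      Matrix.conjTranspose_mul]
    simp only [Matrix.mul_assoc]
  rw [← vNE_conj Q hQ _ (Matrix.isHermitian_mul_conjTranspose_self P), ← hρ1,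
    ← vNE_submatrix w _ (Matrix.isHermitian_mul_conjTranspose_self _), hρ,
    vNE_kron (Matrix.isHermitian_mul_conjTranspose_self P') htr]

theorem sum4 (f : A → H → C → D → ℂ) :
    ∑ a, ∑ b, ∑ c, ∑ d, f a b c d = ∑ b, ∑ c, ∑ d, ∑ a, f a b c d := by
  rw [Finset.sum_comm]
  refine Finset.sum_congr rfl fun b _ => ?_
  rw [Finset.sum_comm]
  refine Finset.sum_congr rfl fun c _ => ?_
  rw [Finset.sum_comm]

theorem trace_mAC [Nonempty A] [Nonempty H] {U : Matrix (C × D) (A × H) ℂ} (hU : IsUnitaryMat U) :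
    trace (mAC U * (mAC U)ᴴ) = 1 := by
  rw [Matrix.trace]
  simp only [Matrix.diag, Matrix.mul_apply, Matrix.conjTranspose_apply, mAC, Matrix.of_apply,
    Fintype.sum_prod_type]
  have h1 : ∑ b : H, ∑ c, ∑ d, ∑ a, chi U a b c d * star (chi U a b c d) = 1 := by
    simp only [flatB hU, if_true]
    rw [Finset.sum_const, Finset.card_univ, nsmul_eq_mul]
    exact mul_inv_cancel₀ (by exact_mod_cast Fintype.card_ne_zero)
  rw [← h1]
  have e : ∀ f : A → H → C → D → ℂ, ∑ a, ∑ c, ∑ b, ∑ d, f a b c d = ∑ b, ∑ c, ∑ d, ∑ a, f a b c d := by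
    intro f
    refine Eq.trans ?_ (sum4 f)
    refine Finset.sum_congr rfl fun a _ => ?_
    rw [Finset.sum_comm]
  exact e (fun a b c d => chi U a b c d * star (chi U a b c d))

theorem trace_mAD [Nonempty A] [Nonempty H] {U : Matrix (C × D) (A × H) ℂ} (hU : IsUnitaryMat U) :
    trace (mAD U * (mAD U)ᴴ) = 1 := by
  rw [Matrix.trace]
  simp only [Matrix.diag, Matrix.mul_apply, Matrix.conjTranspose_apply, mAD, Matrix.of_apply,
    Fintype.sum_prod_type]
  have h1 : ∑ b : H, ∑ c, ∑ d, ∑ a, chi U a b c d * star (chi U a b c d) = 1 := by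
    simp only [flatB hU, if_true]
    rw [Finset.sum_const, Finset.card_univ, nsmul_eq_mul]
    exact mul_inv_cancel₀ (by exact_mod_cast Fintype.card_ne_zero)
  rw [← h1]
  have e : ∀ f : A → H → C → D → ℂ, ∑ a, ∑ d, ∑ b, ∑ c, f a b c d = ∑ b, ∑ c, ∑ d, ∑ a, f a b c d := by
    intro f
    refine Eq.trans ?_ (sum4 f)
    refine Finset.sum_congr rfl fun a _ => ?_
    rw [Finset.sum_comm]
    refine Finset.sum_congr rfl fun b _ => ?_
    rw [Finset.sum_comm]
  exact e (fun a b c d => chi U a b c d * star (chi U a b c d))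

theorem peelP [Nonempty G] [Nonempty A] [Nonempty H] [Nonempty Fc] [Nonempty Fd]
    {Us : Matrix (C × D) (G × (A × H)) ℂ}
    {Us' : Matrix (C' × D') (G × H) ℂ} (hU' : IsUnitaryMat Us')
    (Wc : Matrix (Fc × C') C ℂ) (Wd : Matrix (Fd × D') D ℂ) (V : Matrix (Fc × Fd) A ℂ)
    (hc : IsUnitaryMat Wc) (hd : IsUnitaryMat Wd) (hV : IsUnitaryMat V)
    (hrel : ∀ fc c' fd d' g a h, ∑ c, ∑ d, Wc (fc, c') c * Wd (fd, d') d * Us (c, d) (g, (a, h)) =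
      V (fc, fd) a * Us' (c', d') (g, h))
    (hP : PCond Us) : PCond Us' := by
  have hq : (Real.sqrt (Fintype.card (G × (A × H))) : ℂ)⁻¹ =
      (Real.sqrt (Fintype.card A) : ℂ)⁻¹ * (Real.sqrt (Fintype.card (G × H)) : ℂ)⁻¹ := by
    rw [← mul_inv, ← Complex.ofReal_mul, ← Real.sqrt_mul (by positivity)]
    congr 3
    simp only [Fintype.card_prod]
    push_cast
    ring
  have hcard : (Fintype.card A : ℝ) = Fintype.card Fc * Fintype.card Fd := by
    rw [← unitary_card hV, Fintype.card_prod]; push_cast; rfl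
  have pA : (Fintype.card A : ℝ) ≠ 0 := by exact_mod_cast Fintype.card_ne_zero
  have pG : (Fintype.card (G × H) : ℝ) ≠ 0 := by exact_mod_cast Fintype.card_ne_zero
  have pC : (Fintype.card Fc : ℝ) ≠ 0 := by exact_mod_cast Fintype.card_ne_zero
  have pD : (Fintype.card Fd : ℝ) ≠ 0 := by exact_mod_cast Fintype.card_ne_zero
  have h1 := kron_step (mAC Us) (mAC Us') Wc Wd V hc hd hV (trace_mAC hU') (by
    intro fc c' fd d' g a h
    simp only [mAC, Matrix.of_apply, chi]
    rw [hq]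
    calc _ = ((Real.sqrt (Fintype.card A) : ℂ)⁻¹ * (Real.sqrt (Fintype.card (G × H)) : ℂ)⁻¹) *
          ∑ c, ∑ d, Wc (fc, c') c * Wd (fd, d') d * Us (c, d) (g, (a, h)) := by
            simp only [Finset.mul_sum]
            refine Finset.sum_congr rfl fun c _ => Finset.sum_congr rfl fun d _ => ?_
            ring
      _ = _ := by rw [hrel]; ring)
  have h2 := kron_step (mAD Us) (mAD Us') Wd Wc
    (V.submatrix (Equiv.prodComm Fd Fc) (Equiv.refl A)) hd hc (submatrix_unitary _ _ hV)
    (trace_mAD hU') (by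
    intro fd d' fc c' g a h
    simp only [mAD, Matrix.of_apply, chi]
    rw [hq, Finset.sum_comm]
    calc _ = ((Real.sqrt (Fintype.card A) : ℂ)⁻¹ * (Real.sqrt (Fintype.card (G × H)) : ℂ)⁻¹) *
          ∑ c, ∑ d, Wc (fc, c') c * Wd (fd, d') d * Us (c, d) (g, (a, h)) := by
            simp only [Finset.mul_sum]
            refine Finset.sum_congr rfl fun c _ => Finset.sum_congr rfl fun d _ => ?_
            ring
      _ = _ := by rw [hrel]; simp; ring)
  unfold PCond at hP ⊢
  rw [h1, h2] at hP
  have e : (Fintype.card (G × (A × H)) : ℝ) = Fintype.card (G × H) * (Fintype.card Fc * Fintype.card Fd) := by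
    rw [← hcard]; simp only [Fintype.card_prod]; push_cast; ring
  rw [e, Real.log_mul pG (mul_ne_zero pC pD), Real.log_mul pC pD, add_div, add_div] at hP
  linarith

end peel

open scoped Kronecker
set_option linter.unusedSectionVars false

section splitting
variable {J : Type*} [Fintype J] [DecidableEq J] {γ : J → Type*}
  [∀ j, Fintype (γ j)] [∀ j, DecidableEq (γ j)]
  {A B : Type*} [Fintype A] [DecidableEq A] [Fintype B] [DecidableEq B]

theorem sp_self (j : J) (p : γ j × (∀ k : {k // k ≠ j}, γ k)) :
    (Equiv.piSplitAt j γ).symm p j = p.1 := by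
  simp [Equiv.piSplitAt]

theorem sp_ne (j : J) (p : γ j × (∀ k : {k // k ≠ j}, γ k)) (k : J) (h : k ≠ j) :
    (Equiv.piSplitAt j γ).symm p k = p.2 ⟨k, h⟩ := by
  simp [Equiv.piSplitAt, h]

theorem prod_split (j : J) (f : J → ℂ) : ∏ k, f k = f j * ∏ k : {k // k ≠ j}, f k := by
  rw [Fintype.prod_eq_mul_prod_compl j]
  congr 1
  apply Finset.prod_subtype
  intro x
  simp

theorem hst_of [∀ j, Nonempty (γ j)] [Nonempty A] [Nonempty B]
    {U : Matrix (∀ j, γ j) (A × B) ℂ} (hU : IsUnitaryMat U) (j : J)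
    (hP : PCond (U.submatrix (Equiv.piSplitAt j γ).symm (Equiv.refl _))) (c c' : γ j) :
    ∃ (n : γ j → Matrix (γ j) (γ j) ℂ) (β : γ j → Matrix B B ℂ),
      (∀ c1 b, Commute (eps j (n c1)) (bh U b)) ∧
      eps j (Matrix.single c c' 1) = ∑ c1, eps j (n c1) * bh U (β c1) := by
  have hUs := submatrix_unitary (Equiv.piSplitAt j γ).symm (Equiv.refl (A × B)) hU
  obtain ⟨n, β, h1, h2⟩ := star_bin hUs hP c c'
  have e1 : ∀ x : Matrix (γ j) (γ j) ℂ, eps j x =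
      (x ⊗ₖ (1 : Matrix (∀ k : {k // k ≠ j}, γ k) (∀ k : {k // k ≠ j}, γ k) ℂ)).submatrix
        (Equiv.piSplitAt j γ) (Equiv.piSplitAt j γ) := fun x => rfl
  have e2 : ∀ b : Matrix B B ℂ, bh U b =
      (U.submatrix (Equiv.piSplitAt j γ).symm (Equiv.refl (A × B)) * ((1 : Matrix A A ℂ) ⊗ₖ b) *
        (U.submatrix (Equiv.piSplitAt j γ).symm (Equiv.refl (A × B)))ᴴ).submatrix
        (Equiv.piSplitAt j γ) (Equiv.piSplitAt j γ) := by
    intro b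
    ext x y
    simp only [bh, Matrix.mul_apply, Matrix.submatrix_apply, Matrix.conjTranspose_apply,
      Equiv.symm_apply_apply, Equiv.refl_apply]
  refine ⟨n, β, ?_, ?_⟩
  · intro c1 b
    change _ * _ = _ * _
    rw [e1, e2, Matrix.submatrix_mul_equiv, Matrix.submatrix_mul_equiv, (h1 c1 b).eq]
  · simp only [e1, e2, Matrix.submatrix_mul_equiv]
    rw [h2]
    ext x y
    simp only [Matrix.submatrix_apply, Matrix.sum_apply]

end splitting

theorem main_nondeg (n m : ℕ) (dA : Fin (n + 1) → ℕ) (dC : Fin m → ℕ)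
    (U : Matrix (∀ j, Fin (dC j)) (∀ i, Fin (dA i)) ℂ) (hU : IsUnitaryMat U)
    (hmin : MinScrambling U) (hA : ∀ i, dA i ≠ 0) :
    ∃ (e e' : Fin m → ℕ) (W : ∀ j, Matrix (Fin (e j) × Fin (e' j)) (Fin (dC j)) ℂ)
      (V : Matrix (∀ j, Fin (e j)) (Fin (dA 0)) ℂ)
      (U' : Matrix (∀ j, Fin (e' j)) (∀ i : Fin n, Fin (dA i.succ)) ℂ),
      (∀ j, IsUnitaryMat (W j)) ∧ IsUnitaryMat V ∧ IsUnitaryMat U' ∧ MinScrambling U' ∧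
      ∀ f k a b, (WW W * U) (f, k) (Fin.cons a b) = V f a * U' k b := by
  have nA : ∀ i, Nonempty (Fin (dA i)) := fun i => ⟨⟨0, Nat.pos_of_ne_zero (hA i)⟩⟩
  have nC : ∀ j, Nonempty (Fin (dC j)) := by
    have : Nonempty (∀ j, Fin (dC j)) := by
      rw [← Fintype.card_pos_iff, unitary_card hU]; exact Fintype.card_pos
    intro j
    exact this.map fun f => f j
  let cE : Fin (dA 0) × (∀ i : Fin n, Fin (dA i.succ)) ≃ ∀ i, Fin (dA i) :=
    Fin.consEquiv (fun i => Fin (dA i))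
  have hUs := submatrix_unitary (Equiv.refl (∀ j, Fin (dC j))) cE hU
  obtain ⟨e, e', W, V, U', hW, hV, hU', hfin⟩ := assembly hUs (by
    intro j c c'
    apply hst_of hUs j
    have := (I3_iff cE (Equiv.piSplitAt j (fun j => Fin (dC j))).symm 0 j ?_ ?_ ?_ ?_ U hU).mp (hmin 0 j)
    · exact this
    · intro a b b'; rfl
    · intro i' hi a a' b
      obtain ⟨k, rfl⟩ := Fin.exists_succ_eq.mpr hi
      rfl
    · intro c d d'; rw [sp_self, sp_self]
    · intro j' hj c c' d; rw [sp_ne _ _ _ hj, sp_ne _ _ _ hj])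
  have hfin' : ∀ f k a b, (WW W * U) (f, k) (Fin.cons a b) = V f a * U' k b := by
    intro f k a b
    rw [← hfin]
    rfl
  refine ⟨e, e', W, V, U', hW, hV, hU', ?_, hfin'⟩
  have nF : Nonempty (∀ j, Fin (e j)) := by
    rw [← Fintype.card_pos_iff, unitary_card hV]; exact Fintype.card_pos
  have nF' : Nonempty (∀ j, Fin (e' j)) := by
    rw [← Fintype.card_pos_iff, unitary_card hU']; exact Fintype.card_pos
  have nFj : ∀ j, Nonempty (Fin (e j)) := fun j => nF.map fun f => f j
  have nFj' : ∀ j, Nonempty (Fin (e' j)) := fun j => nF'.map fun f => f j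
  intro i j
  let sA := Equiv.piSplitAt i (fun i : Fin n => Fin (dA i.succ))
  let w : Fin (dA i.succ) × (Fin (dA 0) × (∀ k : {k // k ≠ i}, Fin (dA k.1.succ))) ≃
      Fin (dA 0) × (Fin (dA i.succ) × (∀ k : {k // k ≠ i}, Fin (dA k.1.succ))) :=
    ⟨fun p => (p.2.1, (p.1, p.2.2)), fun p => (p.2.1, (p.1, p.2.2)), fun _ => rfl, fun _ => rfl⟩
  let eA := w.trans ((Equiv.prodCongr (Equiv.refl (Fin (dA 0))) sA.symm).trans cE)
  let eC := (Equiv.piSplitAt j (fun j => Fin (dC j))).symm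
  let eC' := (Equiv.piSplitAt j (fun j => Fin (e' j))).symm
  let eF := (Equiv.piSplitAt j (fun j => Fin (e j))).symm
  have hP : PCond (U.submatrix eC eA) := by
    refine (I3_iff eA eC i.succ j ?_ ?_ ?_ ?_ U hU).mp (hmin i.succ j)
    · rintro g ⟨a, h⟩ ⟨a', h'⟩
      change sA.symm (g, h) i = sA.symm (g, h') i
      rw [sp_self, sp_self]
    · rintro i' hi g g' ⟨a, h⟩
      rcases Fin.eq_zero_or_eq_succ i' with rfl | ⟨k, rfl⟩
      · rfl
      · have hk : k ≠ i := fun h => hi (by rw [h])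
        change sA.symm (g, h) k = sA.symm (g', h) k
        rw [sp_ne _ _ _ hk, sp_ne _ _ _ hk]
    · intro c d d'; rw [sp_self, sp_self]
    · intro j' hj c c' d; rw [sp_ne _ _ _ hj, sp_ne _ _ _ hj]
  refine (I3_iff sA.symm eC' i j ?_ ?_ ?_ ?_ U' hU').mpr ?_
  · intro c d d'; rw [sp_self, sp_self]
  · intro j' hj c c' d; rw [sp_ne _ _ _ hj, sp_ne _ _ _ hj]
  · intro c d d'; rw [sp_self, sp_self]
  · intro j' hj c c' d; rw [sp_ne _ _ _ hj, sp_ne _ _ _ hj]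
  refine peelP (submatrix_unitary eC' sA.symm hU') (W j) (WW fun k : {k // k ≠ j} => W k.1)
    (V.submatrix eF (Equiv.refl _)) (hW j) (WW_unitary fun k => hW k.1)
    (submatrix_unitary _ _ hV) ?_ hP
  intro fc c' fd d' g a h
  have h1 := hfin' (eF (fc, fd)) (eC' (c', d')) a (sA.symm (g, h))
  rw [Matrix.mul_apply, ← eC.sum_comp, Fintype.sum_prod_type] at h1
  refine Eq.trans ?_ h1
  refine Finset.sum_congr rfl fun c _ => Finset.sum_congr rfl fun d _ => ?_
  congr 1
  simp only [WW, Matrix.submatrix_apply, tp_apply, zipE, Equiv.coe_fn_mk, Equiv.refl_apply]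
  rw [prod_split j]
  simp only [eF, eC', eC]
  rw [sp_self, sp_self, sp_self]
  congr 1
  refine Finset.prod_congr rfl fun k _ => ?_
  rw [sp_ne _ _ _ k.2, sp_ne _ _ _ k.2, sp_ne _ _ _ k.2]

open scoped Kronecker
set_option linter.unusedSectionVars false

section one
variable {A B C D : Type*} [Fintype A] [DecidableEq A] [Fintype B] [DecidableEq B]
    [Fintype C] [DecidableEq C] [Fintype D] [DecidableEq D]

theorem PCond_C1 [Nonempty A] [Nonempty B] [Unique C] {U : Matrix (C × D) (A × B) ℂ}
    (hU : IsUnitaryMat U) : PCond U := by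
  have pA : (Fintype.card A : ℝ) ≠ 0 := by exact_mod_cast Fintype.card_ne_zero
  have pB : (Fintype.card B : ℝ) ≠ 0 := by exact_mod_cast Fintype.card_ne_zero
  have h1 : vNE (mAC U * (mAC U)ᴴ) = Real.log (Fintype.card A) / Real.log 2 := by
    rw [vNE_flat']
    · simp
    · rintro ⟨a, c⟩ ⟨a', c'⟩
      have := flatA hU a a'
      rw [Fintype.sum_unique, Finset.sum_comm] at this
      simp only [mAC, Matrix.of_apply, Fintype.sum_prod_type, Unique.eq_default c,
        Unique.eq_default c', this]
      simp
  have h2 : vNE (mAD U * (mAD U)ᴴ) = Real.log (Fintype.card B) / Real.log 2 := by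
    rw [vNE_compl, vNE_flat']
    · simp
    · rintro ⟨a, c⟩ ⟨a', c'⟩
      have := flatB hU a a'
      rw [Fintype.sum_unique, Finset.sum_comm] at this
      simp only [mAD, Matrix.of_apply, Matrix.transpose_apply, Fintype.sum_prod_type,
        Unique.eq_default c, Unique.eq_default c', this]
      simp
  unfold PCond
  rw [h1, h2, Fintype.card_prod, Nat.cast_mul, Real.log_mul pA pB, add_div]

theorem PCond_D1 [Nonempty A] [Nonempty B] [Unique D] {U : Matrix (C × D) (A × B) ℂ}
    (hU : IsUnitaryMat U) : PCond U := by
  have pA : (Fintype.card A : ℝ) ≠ 0 := by exact_mod_cast Fintype.card_ne_zero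
  have pB : (Fintype.card B : ℝ) ≠ 0 := by exact_mod_cast Fintype.card_ne_zero
  have h2 : vNE (mAC U * (mAC U)ᴴ) = Real.log (Fintype.card B) / Real.log 2 := by
    rw [vNE_compl, vNE_flat']
    · simp
    · rintro ⟨a, c⟩ ⟨a', c'⟩
      have := flatB hU a a'
      simp only [Fintype.sum_unique] at this
      rw [Finset.sum_comm] at this
      simp only [mAC, Matrix.of_apply, Matrix.transpose_apply, Fintype.sum_prod_type,
        Unique.eq_default c, Unique.eq_default c', this]
      simp
  have h1 : vNE (mAD U * (mAD U)ᴴ) = Real.log (Fintype.card A) / Real.log 2 := by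
    rw [vNE_flat']
    · simp
    · rintro ⟨a, c⟩ ⟨a', c'⟩
      have := flatA hU a a'
      simp only [Fintype.sum_unique] at this
      rw [Finset.sum_comm] at this
      simp only [mAD, Matrix.of_apply, Fintype.sum_prod_type, Unique.eq_default c,
        Unique.eq_default c', this]
      simp
  unfold PCond
  rw [h1, h2, Fintype.card_prod, Nat.cast_mul, Real.log_mul pA pB, add_div, add_comm]

end one

theorem exists_unitary {m n : Type*} [Fintype m] [DecidableEq m] [Fintype n] [DecidableEq n]
    (h : Fintype.card m = Fintype.card n) : ∃ M : Matrix m n ℂ, IsUnitaryMat M :=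
  ⟨(1 : Matrix n n ℂ).submatrix (Fintype.equivOfCardEq h) (Equiv.refl n),
    submatrix_unitary _ _ ⟨by simp, by simp⟩⟩

theorem vNE_zero {m : Type*} [Fintype m] [DecidableEq m] : vNE (0 : Matrix m m ℂ) = 0 := by
  unfold vNE
  rw [dif_pos Matrix.isHermitian_zero]
  have : (Matrix.isHermitian_zero : (0 : Matrix m m ℂ).IsHermitian).eigenvalues = 0 :=
    (Matrix.IsHermitian.eigenvalues_eq_zero_iff _).mpr rfl
  rw [this]
  simp

section triv
variable {I J : Type*} [Fintype I] [Fintype J] [DecidableEq I] [DecidableEq J]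
    {FA : I → Type u} {FC : J → Type u}
    [∀ i, Fintype (FA i)] [∀ j, Fintype (FC j)]
    [∀ i, DecidableEq (FA i)] [∀ j, DecidableEq (FC j)]

theorem min_empty [IsEmpty (∀ i, FA i)] (U : Matrix (∀ j, FC j) (∀ i, FA i) ℂ) : MinScrambling U := by
  have h0 : mChoi U = 0 := by
    funext h
    exact (‹IsEmpty (∀ i, FA i)›.false (fun i => h (Sum.inl i))).elim
  have h1 : ∀ S : Finset (I ⊕ J), Sm S (mChoi U) = 0 := by
    intro S
    have : marg S (mChoi U) = 0 := by
      ext x y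
      simp [marg, h0]
    rw [Sm, this, vNE_zero]
  intro i j
  unfold I3m Im
  simp [h1]

theorem min_one [∀ i, Nonempty (FA i)] (U : Matrix (∀ j, FC j) (∀ i, FA i) ℂ) (hU : IsUnitaryMat U)
    (j0 : J) (h1 : ∀ j, j ≠ j0 → Fintype.card (FC j) = 1) : MinScrambling U := by
  have nC : ∀ j, Nonempty (FC j) := by
    have : Nonempty (∀ j, FC j) := by
      rw [← Fintype.card_pos_iff, unitary_card hU]; exact Fintype.card_pos
    intro j
    exact this.map fun f => f j
  intro i j
  refine (I3_iff (Equiv.piSplitAt i FA).symm (Equiv.piSplitAt j FC).symm i j ?_ ?_ ?_ ?_ U hU).mpr ?_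
  · intro c d d'; rw [sp_self, sp_self]
  · intro j' hj c c' d; rw [sp_ne _ _ _ hj, sp_ne _ _ _ hj]
  · intro c d d'; rw [sp_self, sp_self]
  · intro j' hj c c' d; rw [sp_ne _ _ _ hj, sp_ne _ _ _ hj]
  have hs := submatrix_unitary (Equiv.piSplitAt j FC).symm (Equiv.piSplitAt i FA).symm hU
  by_cases hj : j = j0
  · subst hj
    obtain ⟨u⟩ := Fintype.card_eq_one_iff_nonempty_unique.mp
      (show Fintype.card (∀ k : {k // k ≠ j}, FC k) = 1 by
        rw [Fintype.card_pi]; exact Finset.prod_eq_one fun k _ => h1 k.1 k.2)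
    exact PCond_D1 hs
  · obtain ⟨u⟩ := Fintype.card_eq_one_iff_nonempty_unique.mp (h1 j hj)
    exact PCond_C1 hs

end triv

theorem peel_eq {n m : ℕ} {dA : Fin (n + 1) → ℕ} {dC : Fin m → ℕ}
    (U : Matrix (∀ j, Fin (dC j)) (∀ i, Fin (dA i)) ℂ)
    {e e' : Fin m → ℕ} (W : ∀ j, Matrix (Fin (e j) × Fin (e' j)) (Fin (dC j)) ℂ)
      (V : Matrix (∀ j, Fin (e j)) (Fin (dA 0)) ℂ)
      (U' : Matrix (∀ j, Fin (e' j)) (∀ i : Fin n, Fin (dA i.succ)) ℂ) (hV : IsUnitaryMat V)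
    (hfin : ∀ f k a b, (WW W * U) (f, k) (Fin.cons a b) = V f a * U' k b)
    (g : ∀ j, Fin (e j) × Fin (e' j)) (f : ∀ j, Fin (e j)) (x : ∀ i : Fin n, Fin (dA i.succ)) :
    (bigWpair W * U * (bigVpeel V)ᴴ) g (f, x) =
      (∏ j, (1 : Matrix (Fin (e j)) (Fin (e j)) ℂ) (g j).1 (f j)) * U' (fun j => (g j).2) x := by
  have h1 : ∏ j, (1 : Matrix (Fin (e j)) (Fin (e j)) ℂ) (g j).1 (f j) =
      (V * Vᴴ) (fun j => (g j).1) f := by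
    rw [hV.1, ← tp_one]; rfl
  have h2 : ∀ a b, (bigWpair W * U) g (Fin.cons a b) = V (fun j => (g j).1) a * U' (fun j => (g j).2) b := by
    intro a b
    rw [← hfin]
    rfl
  rw [h1, Matrix.mul_apply, ← (Fin.consEquiv (fun i => Fin (dA i))).sum_comp, Fintype.sum_prod_type,
    Matrix.mul_apply, Finset.sum_mul]
  refine Finset.sum_congr rfl fun a _ => ?_
  rw [Finset.sum_eq_single x]
  · change (bigWpair W * U) g (Fin.cons a x) * _ = _
    rw [h2]
    simp [Matrix.conjTranspose_apply, bigVpeel, Fin.consEquiv]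
    ring
  · intro b _ hb
    simp [Matrix.conjTranspose_apply, bigVpeel, Fin.consEquiv, hb]
  · simp

theorem mimo_main (n m : ℕ) (dA : Fin (n + 1) → ℕ) (dC : Fin m → ℕ)
    (U : Matrix (∀ j, Fin (dC j)) (∀ i, Fin (dA i)) ℂ) (hU : IsUnitaryMat U)
    (hmin : MinScrambling U) :
    ∃ e e' : Fin m → ℕ, dA 0 = ∏ j, e j ∧ (∀ j, dC j = e j * e' j) ∧
      ∃ (V : Matrix (∀ j, Fin (e j)) (Fin (dA 0)) ℂ)
        (W : ∀ j, Matrix (Fin (e j) × Fin (e' j)) (Fin (dC j)) ℂ)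
        (u : ∀ j, Matrix (Fin (e j)) (Fin (e j)) ℂ)
        (U' : Matrix (∀ j, Fin (e' j)) (∀ i : Fin n, Fin (dA i.succ)) ℂ),
        IsUnitaryMat V ∧ (∀ j, IsUnitaryMat (W j)) ∧ (∀ j, IsUnitaryMat (u j)) ∧
        IsUnitaryMat U' ∧ MinScrambling U' ∧
        ∀ (g : ∀ j, Fin (e j) × Fin (e' j)) (f : ∀ j, Fin (e j))
          (x : ∀ i : Fin n, Fin (dA i.succ)),
          (bigWpair W * U * (bigVpeel V)ᴴ) g (f, x) =
            (∏ j, u j (g j).1 (f j)) * U' (fun j => (g j).2) x := by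
  have hone : ∀ k : ℕ, IsUnitaryMat (1 : Matrix (Fin k) (Fin k) ℂ) := fun k => ⟨by simp, by simp⟩
  by_cases hA : ∀ i, dA i ≠ 0
  · obtain ⟨e, e', W, V, U', hW, hV, hU', hm, hfin⟩ := main_nondeg n m dA dC U hU hmin hA
    refine ⟨e, e', ?_, ?_, V, W, fun j => 1, U', hV, hW, fun j => hone _, hU', hm,
      peel_eq U W V U' hV hfin⟩
    · have := unitary_card hV
      simpa using this.symm
    · intro j
      have := unitary_card (hW j)
      simpa using this.symm
  · push Not at hA
    have hc := unitary_card hU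
    rw [Fintype.card_pi, Fintype.card_pi] at hc
    simp only [Fintype.card_fin] at hc
    have hc0 : ∏ j, dC j = 0 := by
      rw [hc]
      obtain ⟨i, hi⟩ := hA
      exact Finset.prod_eq_zero (Finset.mem_univ i) hi
    obtain ⟨j0, -, hj0⟩ := Finset.prod_eq_zero_iff.mp hc0
    by_cases h0 : dA 0 = 0
    · let e : Fin m → ℕ := fun j => if j = j0 then 0 else dC j
      let e' : Fin m → ℕ := fun j => if j = j0 then ∏ i : Fin n, dA i.succ else 1
      have pe : ∏ j, e j = 0 := Finset.prod_eq_zero (Finset.mem_univ j0) (by simp [e])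
      have pe' : ∏ j, e' j = ∏ i : Fin n, dA i.succ := by simp [e']
      have hd : ∀ j, dC j = e j * e' j := by
        intro j
        by_cases h : j = j0
        · subst h; simp [e, hj0]
        · simp [e, e', h]
      obtain ⟨V, hV⟩ := exists_unitary (m := ∀ j, Fin (e j)) (n := Fin (dA 0)) (by simp [h0, pe])
      choose W hW using fun j => exists_unitary (m := Fin (e j) × Fin (e' j)) (n := Fin (dC j))
        (by simp [← hd])
      obtain ⟨U', hU'⟩ := exists_unitary (m := ∀ j, Fin (e' j)) (n := ∀ i : Fin n, Fin (dA i.succ))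
        (by simp [pe'])
      refine ⟨e, e', by rw [pe, h0], hd, V, W, fun j => 1, U', hV, hW, fun j => hone _, hU', ?_, ?_⟩
      · by_cases hB : ∀ i : Fin n, dA i.succ ≠ 0
        · have nB : ∀ i : Fin n, Nonempty (Fin (dA i.succ)) :=
            fun i => ⟨⟨0, Nat.pos_of_ne_zero (hB i)⟩⟩
          exact min_one U' hU' j0 (by intro j hj; simp [e', hj])
        · push Not at hB
          obtain ⟨i, hi⟩ := hB
          have : IsEmpty (∀ i : Fin n, Fin (dA i.succ)) := ⟨fun x => by
            have := (x i).isLt; omega⟩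
          exact min_empty U'
      · intro g f x
        exfalso
        have := (f j0).isLt
        simp [e] at this
    · obtain ⟨i, hi⟩ := hA
      obtain ⟨k, rfl⟩ := Fin.exists_succ_eq.mpr (show i ≠ 0 by rintro rfl; exact h0 hi)
      let e : Fin m → ℕ := fun j => if j = j0 then dA 0 else 1
      let e' : Fin m → ℕ := fun j => if j = j0 then 0 else dC j
      have pe : ∏ j, e j = dA 0 := by simp [e]
      have pe' : ∏ j, e' j = ∏ i : Fin n, dA i.succ := by
        rw [Finset.prod_eq_zero (Finset.mem_univ j0) (by simp [e']),
          Finset.prod_eq_zero (Finset.mem_univ k) hi]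
      have hd : ∀ j, dC j = e j * e' j := by
        intro j
        by_cases h : j = j0
        · subst h; simp [e', hj0]
        · simp [e, e', h]
      obtain ⟨V, hV⟩ := exists_unitary (m := ∀ j, Fin (e j)) (n := Fin (dA 0)) (by simp [pe])
      choose W hW using fun j => exists_unitary (m := Fin (e j) × Fin (e' j)) (n := Fin (dC j))
        (by simp [← hd])
      obtain ⟨U', hU'⟩ := exists_unitary (m := ∀ j, Fin (e' j)) (n := ∀ i : Fin n, Fin (dA i.succ))
        (by simp [pe'])
      have hem : IsEmpty (∀ i : Fin n, Fin (dA i.succ)) := ⟨fun x => by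
            have := (x k).isLt; omega⟩
      refine ⟨e, e', pe.symm, hd, V, W, fun j => 1, U', hV, hW, fun j => hone _, hU',
        min_empty U', ?_⟩
      intro g f x
      exact isEmptyElim x

/-- From a minimally I₃-scrambling MIMO unitary one can peel off the
first input: `U = (⊗ⱼ U_{1→j}) ⊗ U'` with respect to decompositions `A₁ = ⊗ⱼ A_{1→j}` and
`C_j = C_{1→j} ⊗ C'_j`, where `U' : A₂ ⊗ ⋯ ⊗ A_n → C'₁ ⊗ ⋯ ⊗ C'_m` is again a minimally
I₃-scrambling MIMO unitary. -/
theorem mimo_peel_first_input (n m : ℕ) (dA : Fin (n + 1) → ℕ) (dC : Fin m → ℕ)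
    (U : Matrix (∀ j, Fin (dC j)) (∀ i, Fin (dA i)) ℂ) (hU : IsUnitaryMat U)
    (hmin : MinScrambling U) :
    ∃ e e' : Fin m → ℕ, dA 0 = ∏ j, e j ∧ (∀ j, dC j = e j * e' j) ∧
      ∃ (V : Matrix (∀ j, Fin (e j)) (Fin (dA 0)) ℂ)
        (W : ∀ j, Matrix (Fin (e j) × Fin (e' j)) (Fin (dC j)) ℂ)
        (u : ∀ j, Matrix (Fin (e j)) (Fin (e j)) ℂ)
        (U' : Matrix (∀ j, Fin (e' j)) (∀ i : Fin n, Fin (dA i.succ)) ℂ),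
        IsUnitaryMat V ∧ (∀ j, IsUnitaryMat (W j)) ∧ (∀ j, IsUnitaryMat (u j)) ∧
        IsUnitaryMat U' ∧ MinScrambling U' ∧
        ∀ (g : ∀ j, Fin (e j) × Fin (e' j)) (f : ∀ j, Fin (e j))
          (x : ∀ i : Fin n, Fin (dA i.succ)),
          (bigWpair W * U * (bigVpeel V)ᴴ) g (f, x) =
            (∏ j, u j (g j).1 (f j)) * U' (fun j => (g j).2) x := by
  exact mimo_main n m dA dC U hU hmin

end Scrambling

end
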